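/- Let the equilateral triangle ABC be N-tiled by a tile with angles (α, β, γ), where γ = π/3 or γ = 2π/3, and α is not a rational multiple of π. Then N ≥ 40. -/

import Mathlib

open EuclideanGeometry Real

noncomputable section

/-- A point of the Euclidean plane. -/
abbrev Pt : Type := EuclideanSpace ℝ (Fin 2)

/-- A triangle, given by its three vertices. -/
abbrev Tri : Type := Fin 3 → Pt

/-- A genuine (nondegenerate) triangle. -/
def IsTriangle (T : Tri) : Prop := AffineIndependent ℝ T

/-- The closed triangle (convex hull of the vertices). -/
def triSet (T : Tri) : Set Pt := convexHull ℝ (Set.range T)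

/-- Two triangles are congruent iff corresponding distances agree
up to a permutation of the vertices. -/
def CongruentTri (T₁ T₂ : Tri) : Prop :=
  ∃ σ : Equiv.Perm (Fin 3), ∀ i j : Fin 3, dist (T₁ i) (T₁ j) = dist (T₂ (σ i)) (T₂ (σ j))

/-- An `N`-tiling of the triangle `ABC` by the tile `T`: a family of `N` triangles,
each congruent to `T`, with pairwise disjoint interiors, whose union is the
closed triangle `ABC`. -/
structure IsTiling (N : ℕ) (ABC T : Tri) (tiles : Fin N → Tri) : Prop where
  congr : ∀ i, CongruentTri (tiles i) T
  disj : ∀ i j, i ≠ j → interior (triSet (tiles i)) ∩ interior (triSet (tiles j)) = ∅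
  cover : (⋃ i, triSet (tiles i)) = triSet ABC

/-- The interior angle of the triangle `T` at its `k`-th vertex. -/
def triAngle (T : Tri) (k : Fin 3) : ℝ := ∠ (T (k + 1)) (T k) (T (k + 2))

/-- The side of `T` opposite to the `k`-th vertex. -/
def sideLen (T : Tri) (k : Fin 3) : ℝ := dist (T (k + 1)) (T (k + 2))

/-- `T` has angles `α`, `β`, `γ` (at vertices `0`, `1`, `2`, which are opposite
the sides of lengths `a`, `b`, `c` respectively). -/
def HasAngles (T : Tri) (α β γ : ℝ) : Prop :=
  triAngle T 0 = α ∧ triAngle T 1 = β ∧ triAngle T 2 = γ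

/-- Two triangles are similar iff corresponding distances agree up to a
permutation of the vertices and a positive scale factor. -/
def SimilarTri (T₁ T₂ : Tri) : Prop :=
  ∃ r : ℝ, 0 < r ∧ ∃ σ : Equiv.Perm (Fin 3),
    ∀ i j : Fin 3, dist (T₁ i) (T₁ j) = r * dist (T₂ (σ i)) (T₂ (σ j))

/-- A triangle is equilateral if its three sides have equal length. -/
def IsEquilateral (T : Tri) : Prop :=
  dist (T 0) (T 1) = dist (T 1) (T 2) ∧ dist (T 0) (T 1) = dist (T 0) (T 2)




def crs (u v : ℂ) : ℝ := u.re * v.im - u.im * v.re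
def lam (V : Fin 3 → ℂ) (k : Fin 3) (z : ℂ) : ℝ := crs (V (k + 1) - V k) (z - V k)
def CloIn (V : Fin 3 → ℂ) (z : ℂ) : Prop := ∀ k, 0 ≤ lam V k z
def StrIn (V : Fin 3 → ℂ) (z : ℂ) : Prop := ∀ k, 0 < lam V k z
def LPos (x y w : ℝ) : Prop := 0 < x ∨ (x = 0 ∧ (0 < y ∨ (y = 0 ∧ 0 < w)))
def LexIn (V : Fin 3 → ℂ) (v r n : ℂ) : Prop :=
  ∀ k, LPos (lam V k v) (crs (V (k + 1) - V k) r) (crs (V (k + 1) - V k) n)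

structure TileSys (N : ℕ) (B : Fin 3 → ℂ) (V : Fin N → Fin 3 → ℂ) : Prop where
  posB : 0 < lam B 0 (B 2)
  posV : ∀ i, 0 < lam (V i) 0 (V i 2)
  cov : ∀ z, CloIn B z ↔ ∃ i, CloIn (V i) z
  dis : ∀ i j z, StrIn (V i) z → StrIn (V j) z → i = j

theorem lpos_ev {x y w : ℝ} (h : LPos x y w) :
    ∀ᶠ e in nhdsWithin (0 : ℝ) (Set.Ioi 0), 0 < x + e * y + e ^ 2 * w := by
  have h0 : ∀ᶠ e in nhdsWithin (0 : ℝ) (Set.Ioi 0), 0 < e := eventually_mem_nhdsWithin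
  rcases h with h | ⟨h, h1 | ⟨h1, h2⟩⟩
  · have : Filter.Tendsto (fun e : ℝ => x + e * y + e ^ 2 * w) (nhdsWithin 0 (Set.Ioi 0)) (nhds (x + 0 * y + 0 ^ 2 * w)) := by
      apply Filter.Tendsto.mono_left _ nhdsWithin_le_nhds
      exact Continuous.tendsto (by fun_prop) 0
    refine this.eventually_const_lt ?_
    simpa using h
  · have : Filter.Tendsto (fun e : ℝ => y + e * w) (nhdsWithin 0 (Set.Ioi 0)) (nhds (y + 0 * w)) := by
      apply Filter.Tendsto.mono_left _ nhdsWithin_le_nhds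
      exact Continuous.tendsto (by fun_prop) 0
    have h3 := this.eventually_const_lt (show (0:ℝ) < y + 0 * w by simpa using h1)
    filter_upwards [h3, h0] with e he he0
    have := mul_pos he0 he
    rw [h]; nlinarith
  · filter_upwards [h0] with e he0
    rw [h, h1]; have := pow_pos he0 2; nlinarith [mul_pos this h2]

theorem lpos_tri (x y w : ℝ) : LPos x y w ∨ LPos (-x) (-y) (-w) ∨ (x = 0 ∧ y = 0 ∧ w = 0) := by
  unfold LPos
  rcases lt_trichotomy x 0 with h | h | h <;> rcases lt_trichotomy y 0 with h1 | h1 | h1 <;>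
    rcases lt_trichotomy w 0 with h2 | h2 | h2 <;> simp [h, h1, h2]

def germ (v r n : ℂ) (e : ℝ) : ℂ := v + e * r + (e ^ 2 : ℝ) * n

theorem lam_germ (V : Fin 3 → ℂ) (k : Fin 3) (v r n : ℂ) (e : ℝ) :
    lam V k (germ v r n e) = lam V k v + e * crs (V (k + 1) - V k) r
      + e ^ 2 * crs (V (k + 1) - V k) n := by
  simp [lam, crs, germ, -Complex.ofReal_pow]; ring

theorem lex_ev {V : Fin 3 → ℂ} {v r n : ℂ} (h : LexIn V v r n) :
    ∀ᶠ e in nhdsWithin (0 : ℝ) (Set.Ioi 0), StrIn V (germ v r n e) := by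
  unfold StrIn
  rw [Filter.eventually_all]
  intro k
  filter_upwards [lpos_ev (h k)] with e he
  rwa [lam_germ]

theorem lam_cyc (V : Fin 3 → ℂ) (k : Fin 3) : lam V k (V (k + 2)) = lam V 0 (V 2) := by
  fin_cases k <;> simp [lam, crs] <;> ring

theorem edge_ne {V : Fin 3 → ℂ} (hV : 0 < lam V 0 (V 2)) (k : Fin 3) : V (k + 1) - V k ≠ 0 := by
  intro h
  have := lam_cyc V k
  rw [← this] at hV
  simp [lam, h, crs] at hV

theorem crs_zero {e r n : ℂ} (hrn : crs r n ≠ 0) (h1 : crs e r = 0) (h2 : crs e n = 0) : e = 0 := by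
  unfold crs at *
  apply Complex.ext
  · have : e.re * (r.re * n.im - r.im * n.re) = 0 := by linear_combination r.re * h2 - n.re * h1
    simpa [hrn] using this
  · have : e.im * (r.re * n.im - r.im * n.re) = 0 := by linear_combination r.im * h2 - n.im * h1
    simpa [hrn] using this

theorem lex_of_freq {V : Fin 3 → ℂ} {v r n : ℂ} (hV : 0 < lam V 0 (V 2)) (hrn : crs r n ≠ 0)
    (h : ∃ᶠ e in nhdsWithin (0 : ℝ) (Set.Ioi 0), CloIn V (germ v r n e)) :
    LexIn V v r n := by
  intro k
  rcases lpos_tri (lam V k v) (crs (V (k + 1) - V k) r) (crs (V (k + 1) - V k) n) with h1 | h1 | h1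
  · exact h1
  · exfalso
    obtain ⟨e, he1, he2⟩ := (h.and_eventually (lpos_ev h1)).exists
    have := he1 k
    rw [lam_germ] at this
    linarith
  · exact absurd (crs_zero hrn h1.2.1 h1.2.2) (edge_ne hV k)

theorem StrIn.clo {V : Fin 3 → ℂ} {z : ℂ} (h : StrIn V z) : CloIn V z := fun k => (h k).le

namespace TileSys
variable {N : ℕ} {B : Fin 3 → ℂ} {V : Fin N → Fin 3 → ℂ}

theorem lex_uniq (S : TileSys N B V) {v r n : ℂ} {i j : Fin N} (hi : LexIn (V i) v r n)
    (hj : LexIn (V j) v r n) : i = j := by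
  obtain ⟨e, h1, h2⟩ := ((lex_ev hi).and (lex_ev hj)).exists
  exact S.dis i j _ h1 h2

theorem lex_up (S : TileSys N B V) {v r n : ℂ} (hrn : crs r n ≠ 0) {i : Fin N}
    (hi : LexIn (V i) v r n) : LexIn B v r n := by
  apply lex_of_freq S.posB hrn
  apply Filter.Eventually.frequently
  filter_upwards [lex_ev hi] with e he
  exact (S.cov _).2 ⟨i, he.clo⟩

theorem lex_ex (S : TileSys N B V) {v r n : ℂ} (hrn : crs r n ≠ 0)
    (hB : LexIn B v r n) : ∃ i, LexIn (V i) v r n := by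
  by_contra hcon
  push Not at hcon
  have h1 : ∀ i, ∀ᶠ e in nhdsWithin (0 : ℝ) (Set.Ioi 0),
      ¬ CloIn (V i) (germ v r n e) := by
    intro i
    have := mt (lex_of_freq (S.posV i) hrn) (hcon i)
    rwa [Filter.not_frequently] at this
  rw [← Filter.eventually_all] at h1
  obtain ⟨e, he1, he2⟩ := (h1.and (lex_ev hB)).exists
  obtain ⟨i, hi⟩ := (S.cov _).1 he2.clo
  exact he1 i hi

open Classical in
theorem lex_count (S : TileSys N B V) {v r n : ℂ} (hrn : crs r n ≠ 0) :
    ∑ i, (if LexIn (V i) v r n then (1 : ℝ) else 0) = if LexIn B v r n then 1 else 0 := by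
  split_ifs with h
  · obtain ⟨i, hi⟩ := S.lex_ex hrn h
    rw [Finset.sum_eq_single i]
    · simp [hi]
    · intro j _ hj
      rw [if_neg]
      intro h2
      exact hj (S.lex_uniq h2 hi)
    · simp
  · apply Finset.sum_eq_zero
    intro i _
    rw [if_neg]
    intro h2
    exact h (S.lex_up hrn h2)

end TileSys



def pln (u : ℂ) (s t : ℝ) : ℂ := t * u + s * (Complex.I * u)
open Classical in
def Jf (V : Fin 3 → ℂ) (u : ℂ) (s t : ℝ) : ℝ :=
  (if LexIn V (pln u s t) (Complex.I * u) u then 1 else 0) -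
  (if LexIn V (pln u s t) (-(Complex.I * u)) u then 1 else 0)
open Classical in
def kc (u : ℂ) (s : ℝ) (d : ℂ) (s' : ℝ) : ℝ :=
  (if d = u ∧ s' = s then 1 else 0) - (if d = -u ∧ s' = -s then 1 else 0)

theorem unit_re_im {u : ℂ} (hu : ‖u‖ = 1) : u.re * u.re + u.im * u.im = 1 := by
  have := Complex.normSq_eq_norm_sq u
  rw [hu, Complex.normSq_apply] at this; simpa using this

theorem pln_rep {u : ℂ} (hu : ‖u‖ = 1) (z : ℂ) :
    z = pln u (crs u z) (u.re * z.re + u.im * z.im) := by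
  have h := unit_re_im hu
  apply Complex.ext <;> simp [pln, crs]
  · linear_combination (-z.re) * h
  · linear_combination (-z.im) * h

theorem fin3a (k : Fin 3) : k + 1 + 1 = k + 2 := by fin_cases k <;> rfl
theorem fin3b (k : Fin 3) : k + 2 + 1 = k := by fin_cases k <;> rfl
theorem fin3c (k : Fin 3) (P : Fin 3 → Prop) : (∀ j, P j) ↔ P k ∧ P (k + 1) ∧ P (k + 2) := by
  constructor
  · intro h; exact ⟨h _, h _, h _⟩
  · intro h j; fin_cases k <;> fin_cases j <;> simp_all

theorem lam_pln (V : Fin 3 → ℂ) (k : Fin 3) (u : ℂ) (s t : ℝ) :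
    lam V k (pln u s t) = lam V k (pln u s 0) + t * crs (V (k + 1) - V k) u := by
  simp [lam, pln, crs]; ring

theorem lpos_ne {x y w : ℝ} (h : x ≠ 0) : LPos x y w ↔ 0 < x := by
  simp [LPos, h]

theorem crs_neg_right (e r : ℂ) : crs e (-r) = - crs e r := by simp [crs]; ring
theorem crs_smul_left (l : ℝ) (e r : ℂ) : crs (l * e) r = l * crs e r := by simp [crs]; ring
theorem crs_smul_right (l : ℝ) (e r : ℂ) : crs e (l * r) = l * crs e r := by simp [crs]; ring

theorem J_none {V : Fin 3 → ℂ} {u : ℂ} {s : ℝ}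
    (h : ∀ k, ¬ (crs (V (k + 1) - V k) u = 0 ∧ lam V k (pln u s 0) = 0)) :
    Jf V u s =ᵐ[MeasureTheory.volume] 0 := by
  have h1 : ∀ k, ∀ᵐ t : ℝ, lam V k (pln u s t) ≠ 0 := by
    intro k
    have : ({t | ¬ lam V k (pln u s t) ≠ 0} : Set ℝ).Subsingleton := by
      intro t ht t' ht'
      simp only [ne_eq, not_not, Set.mem_ofPred_eq] at ht ht'
      rw [lam_pln] at ht ht'
      by_contra hne
      apply h k
      have h3 : crs (V (k + 1) - V k) u = 0 := by
        have : (t - t') * crs (V (k + 1) - V k) u = 0 := by linear_combination ht - ht'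
        rcases mul_eq_zero.1 this with h5 | h5
        · exact absurd (sub_eq_zero.1 h5) hne
        · exact h5
      refine ⟨h3, ?_⟩
      rw [h3] at ht; linarith
    exact this.measure_zero MeasureTheory.volume
  rw [← MeasureTheory.ae_all_iff] at h1
  filter_upwards [h1] with t ht
  simp only [Jf, LexIn, Pi.zero_apply]
  simp only [lpos_ne (ht _), sub_self]

theorem J_edge {V : Fin 3 → ℂ} (hV : 0 < lam V 0 (V 2)) {u : ℂ} (hu : ‖u‖ = 1) {s : ℝ}
    {k : Fin 3} {l σ : ℝ} (hl : 0 < l) (hσ : σ * σ = 1) (he : V (k + 1) - V k = l * (σ * u))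
    (hs : crs (σ * u) (V k) = σ * s) :
    Jf V u s =ᵐ[MeasureTheory.volume] fun t => σ *
      Set.indicator {t : ℝ | 0 < σ * (t - (u.re * (V k).re + u.im * (V k).im)) ∧
        σ * (t - (u.re * (V k).re + u.im * (V k).im)) < l} 1 t := by
  set t0 := u.re * (V k).re + u.im * (V k).im with ht0
  have hu' := unit_re_im hu
  have hs' : crs u (V k) = s := by
    rw [crs_smul_left] at hs
    have : σ * (σ * crs u (V k)) = σ * (σ * s) := by rw [hs]
    rw [← mul_assoc, ← mul_assoc, hσ] at this; linarith
  have hVk : V k = pln u s t0 := by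
    have := pln_rep hu (V k); rwa [hs'] at this
  have hVk1 : V (k + 1) = pln u s (t0 + σ * l) := by
    have : V (k + 1) = V k + l * (σ * u) := by rw [← he]; ring
    rw [this, hVk]; simp [pln]; ring
  have hD := lam_cyc V k
  set D := lam V 0 (V 2) with hDdef
  have e0 : ∀ t, lam V k (pln u s t) = 0 := by
    intro t
    rw [lam, he, hVk]
    simp [pln, crs]; ring
  have e0n : crs (V (k + 1) - V k) (Complex.I * u) = l * σ := by
    rw [he]; simp [crs]; linear_combination l * σ * hu'
  have hc : l * σ * crs u (V (k + 2) - V k) = D := by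
    rw [← hD, lam, he, crs_smul_left, crs_smul_left]; ring
  have hc2 : l * crs u (V (k + 2) - V k) = σ * D := by
    linear_combination σ * hc - l * crs u (V (k + 2) - V k) * hσ
  have e1 : ∀ t, l * lam V (k + 1) (pln u s t) = (l - σ * (t - t0)) * D := by
    intro t
    have : lam V (k + 1) (pln u s t) = (t0 + σ * l - t) * crs u (V (k + 2) - V k) := by
      rw [lam, fin3a, hVk1, hVk]
      simp [pln, crs]; ring
    rw [this]; linear_combination (t0 + σ * l - t) * hc2 + l * D * hσ
  have e2 : ∀ t, l * lam V (k + 2) (pln u s t) = (σ * (t - t0)) * D := by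
    intro t
    have : lam V (k + 2) (pln u s t) = (t - t0) * crs u (V (k + 2) - V k) := by
      rw [lam, fin3b, hVk]
      simp [pln, crs]; ring
    rw [this]; linear_combination (t - t0) * hc2
  have hσ' : σ = 1 ∨ σ = -1 := by
    have : (σ - 1) * (σ + 1) = 0 := by linarith
    rcases mul_eq_zero.1 this with h | h
    · left; linarith
    · right; linarith
  have f1 : ∀ᵐ t : ℝ, t ≠ t0 := by
    simp [MeasureTheory.ae_iff]
  have f2 : ∀ᵐ t : ℝ, t ≠ t0 + σ * l := by
    simp [MeasureTheory.ae_iff]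
  filter_upwards [f1, f2] with t h1 h2
  have n2 : lam V (k + 2) (pln u s t) ≠ 0 := by
    intro h
    have h3 := e2 t
    rw [h] at h3
    have : (t - t0) ≠ 0 := sub_ne_zero.2 h1
    have h5 : σ ≠ 0 := by rintro rfl; simp at hσ
    simp [this, hV.ne', h5] at h3
  have n1 : lam V (k + 1) (pln u s t) ≠ 0 := by
    intro h
    have h3 := e1 t
    rw [h] at h3
    simp only [mul_zero, zero_eq_mul, hV.ne', or_false] at h3
    apply h2
    linear_combination (-σ) * h3 - (t - t0) * hσ
  have p1 : 0 < lam V (k + 1) (pln u s t) ↔ σ * (t - t0) < l := by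
    rw [← mul_pos_iff_of_pos_left hl, e1, mul_pos_iff_of_pos_right hV, sub_pos]
  have p2 : 0 < lam V (k + 2) (pln u s t) ↔ 0 < σ * (t - t0) := by
    rw [← mul_pos_iff_of_pos_left hl, e2, mul_pos_iff_of_pos_right hV]
  have q1 : LexIn V (pln u s t) (Complex.I * u) u ↔ (0 < l * σ ∧ σ * (t - t0) < l ∧ 0 < σ * (t - t0)) := by
    rw [LexIn, fin3c k, lpos_ne n1, lpos_ne n2, e0, e0n, p1, p2]
    have : l * σ ≠ 0 := by rcases hσ' with rfl | rfl <;> simp [hl.ne']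
    simp [LPos, this]
  have q2 : LexIn V (pln u s t) (-(Complex.I * u)) u ↔ (0 < -(l * σ) ∧ σ * (t - t0) < l ∧ 0 < σ * (t - t0)) := by
    rw [LexIn, fin3c k, lpos_ne n1, lpos_ne n2, e0, crs_neg_right, e0n, p1, p2]
    have : l * σ ≠ 0 := by rcases hσ' with rfl | rfl <;> simp [hl.ne']
    simp [LPos, this]
  simp only [Jf, q1, q2, Set.indicator, Set.mem_ofPred_eq, Pi.one_apply]
  rcases hσ' with rfl | rfl
  · have : ¬ (0 < -(l * 1)) := by linarith
    have h4 : 0 < l * 1 := by linarith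
    simp only [this, h4, false_and, true_and, if_false, and_comm]; simp
  · have h4 : 0 < -(l * -1) := by linarith
    have : ¬ (0 < (l * -1)) := by linarith
    simp only [this, h4, false_and, true_and, if_false, and_comm]; split_ifs <;> simp

theorem ind_int {σ t0 l : ℝ} (hl : 0 < l) (hσ : σ * σ = 1) :
    MeasureTheory.Integrable (fun t => σ * Set.indicator {t : ℝ | 0 < σ * (t - t0) ∧
        σ * (t - t0) < l} (1 : ℝ → ℝ) t) ∧
    ∫ t, σ * Set.indicator {t : ℝ | 0 < σ * (t - t0) ∧ σ * (t - t0) < l} (1 : ℝ → ℝ) t = σ * l := by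
  have hset : ∃ x, {t : ℝ | 0 < σ * (t - t0) ∧ σ * (t - t0) < l} = Set.Ioo x (x + l) := by
    have : (σ - 1) * (σ + 1) = 0 := by linarith
    rcases mul_eq_zero.1 this with h | h
    · have : σ = 1 := by linarith
      subst this
      refine ⟨t0, ?_⟩
      ext t; simp only [Set.mem_ofPred_eq, Set.mem_Ioo]
      constructor <;> rintro ⟨h1, h2⟩ <;> constructor <;> linarith
    · have : σ = -1 := by linarith
      subst this
      refine ⟨t0 - l, ?_⟩
      ext t; simp only [Set.mem_ofPred_eq, Set.mem_Ioo]
      constructor <;> rintro ⟨h1, h2⟩ <;> constructor <;> linarith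
  obtain ⟨x, hx⟩ := hset
  rw [hx]
  constructor
  · apply MeasureTheory.Integrable.const_mul
    exact MeasureTheory.IntegrableOn.integrable_indicator (by simp [Pi.one_def]) measurableSet_Ioo
  · rw [MeasureTheory.integral_const_mul, MeasureTheory.integral_indicator_one measurableSet_Ioo]
    simp [MeasureTheory.Measure.real, hl.le]

theorem J_int {V : Fin 3 → ℂ} (hV : 0 < lam V 0 (V 2)) {u : ℂ} (hu : ‖u‖ = 1) {s : ℝ}
    {l : Fin 3 → ℝ} {d : Fin 3 → ℂ} (hl : ∀ k, 0 < l k) (hd : ∀ k, ‖d k‖ = 1)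
    (he : ∀ k, V (k + 1) - V k = l k * d k) :
    MeasureTheory.Integrable (Jf V u s) ∧
    ∫ t, Jf V u s t = ∑ k, l k * kc u s (d k) (crs (d k) (V k)) := by
  have hu0 : u ≠ 0 := by rintro rfl; simp at hu
  have huu : u ≠ -u := by
    intro h; exact hu0 (by linear_combination (1/2) * h)
  have hpar : ∀ k j, j ≠ k → crs (d k) (d j) ≠ 0 := by
    intro k j hjk h
    have h1 := lam_cyc V k
    have h2 : crs (V (k + 1) - V k) (V (j + 1) - V j) = 0 := by
      rw [he, he, crs_smul_left, crs_smul_right, h]; ring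
    have h3 : j = k + 1 ∨ j = k + 2 := by
      revert hjk; fin_cases k <;> fin_cases j <;> simp
    rcases h3 with rfl | rfl
    · rw [fin3a] at h2
      have : lam V k (V (k + 2)) = crs (V (k + 1) - V k) (V (k + 2) - V (k + 1)) := by
        simp [lam, crs]; ring
      rw [this, h2] at h1; linarith
    · rw [fin3b] at h2
      have : lam V k (V (k + 2)) = - crs (V (k + 1) - V k) (V k - V (k + 2)) := by
        simp [lam, crs]; ring
      rw [this, h2] at h1; linarith
  by_cases hex : ∃ k, ∃ σ : ℝ, σ * σ = 1 ∧ d k = σ * u ∧ crs (d k) (V k) = σ * s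
  · obtain ⟨k, σ, hσ, hdk, hsk⟩ := hex
    have hJ := J_edge hV hu (hl k) hσ (by rw [he k, hdk]) (by rw [← hdk]; exact hsk)
    obtain ⟨i1, i2⟩ := ind_int (t0 := u.re * (V k).re + u.im * (V k).im) (hl k) hσ
    refine ⟨i1.congr hJ.symm, ?_⟩
    rw [MeasureTheory.integral_congr_ae hJ, i2, Finset.sum_eq_single k]
    · have hσ' : σ = 1 ∨ σ = -1 := by
        have : (σ - 1) * (σ + 1) = 0 := by linarith
        rcases mul_eq_zero.1 this with h | h
        · left; linarith
        · right; linarith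
      rcases hσ' with rfl | rfl
      · simp at hdk hsk
        simp only [kc, hsk]; simp [hdk, huu]
      · simp at hdk hsk
        simp only [kc, hsk]; simp [hdk, huu.symm]
    · intro j _ hj
      have h4 := hpar k j hj
      have : d j ≠ u ∧ d j ≠ -u := by
        constructor <;> intro h5 <;> apply h4 <;> rw [hdk, h5] <;> simp [crs] <;> ring
      simp [kc, this.1, this.2]
    · simp
  · have hJ : Jf V u s =ᵐ[MeasureTheory.volume] 0 := by
      apply J_none
      rintro k ⟨h1, h2⟩
      apply hex
      rw [he k, crs_smul_left] at h1
      have h1' : crs (d k) u = 0 := by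
        rcases mul_eq_zero.1 h1 with h | h
        · exact absurd h (hl k).ne'
        · exact h
      have h3 := pln_rep hu (d k)
      have h4 : crs u (d k) = 0 := by
        have : crs u (d k) = - crs (d k) u := by simp [crs]; ring
        rw [this, h1']; simp
      rw [h4] at h3
      set σ := u.re * (d k).re + u.im * (d k).im
      have h5 : d k = σ * u := by rw [h3]; simp [pln]
      refine ⟨k, σ, ?_, h5, ?_⟩
      · have a1 := unit_re_im (hd k)
        rw [h5] at a1
        simp at a1
        linear_combination a1 - σ * σ * unit_re_im hu
      · rw [lam, he k, crs_smul_left] at h2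
        have h2' : crs (d k) (pln u s 0 - V k) = 0 := by
          rcases mul_eq_zero.1 h2 with h | h
          · exact absurd h (hl k).ne'
          · exact h
        have : crs (d k) (pln u s 0) = σ * s := by
          rw [h5, crs_smul_left]
          have a1 := unit_re_im hu
          simp only [crs, pln]
          simp only [Complex.add_re, Complex.add_im, Complex.mul_re, Complex.mul_im, Complex.ofReal_re, Complex.ofReal_im, Complex.I_re, Complex.I_im]
          linear_combination σ * s * a1
        have h6 : crs (d k) (pln u s 0 - V k) = crs (d k) (pln u s 0) - crs (d k) (V k) := by
          simp [crs]; ring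
        linarith
    have hz : ∀ k, kc u s (d k) (crs (d k) (V k)) = 0 := by
      intro k
      have n1 : ¬ (d k = u ∧ crs (d k) (V k) = s) := by
        rintro ⟨h1, h2⟩; exact hex ⟨k, 1, by simp, by simpa using h1, by simpa using h2⟩
      have n2 : ¬ (d k = -u ∧ crs (d k) (V k) = -s) := by
        rintro ⟨h1, h2⟩; exact hex ⟨k, -1, by simp, by simpa using h1, by simpa using h2⟩
      simp only [kc, n1, n2, if_false, sub_self]
    refine ⟨(MeasureTheory.integrable_zero ℝ ℝ MeasureTheory.volume).congr hJ.symm, ?_⟩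
    rw [MeasureTheory.integral_congr_ae hJ]
    simp [hz]

theorem balance {N : ℕ} {B : Fin 3 → ℂ} {V : Fin N → Fin 3 → ℂ} (S : TileSys N B V)
    {L : Fin 3 → ℝ} {E : Fin 3 → ℂ} (hL : ∀ k, 0 < L k) (hE : ∀ k, ‖E k‖ = 1)
    (hB : ∀ k, B (k + 1) - B k = L k * E k)
    {l : Fin N → Fin 3 → ℝ} {d : Fin N → Fin 3 → ℂ} (hl : ∀ i k, 0 < l i k)
    (hd : ∀ i k, ‖d i k‖ = 1) (he : ∀ i k, V i (k + 1) - V i k = l i k * d i k)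
    {u : ℂ} (hu : ‖u‖ = 1) (s : ℝ) :
    ∑ i, ∑ k, l i k * kc u s (d i k) (crs (d i k) (V i k)) =
      ∑ k, L k * kc u s (E k) (crs (E k) (B k)) := by
  rw [← (J_int S.posB hu hL hE hB).2]
  have h1 : ∀ i, ∑ k, l i k * kc u s (d i k) (crs (d i k) (V i k)) = ∫ t, Jf (V i) u s t :=
    fun i => ((J_int (S.posV i) hu (hl i) (hd i) (he i)).2).symm
  simp only [h1]
  rw [← MeasureTheory.integral_finsetSum _
    (fun i _ => (J_int (S.posV i) hu (hl i) (hd i) (he i)).1)]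
  congr 1
  funext t
  have hc : crs (Complex.I * u) u ≠ 0 := by
    have := unit_re_im hu
    simp [crs]; intro h; linarith
  have hc2 : crs (-(Complex.I * u)) u ≠ 0 := by
    have := unit_re_im hu
    simp [crs]; intro h; linarith
  simp only [Jf, Finset.sum_sub_distrib]
  rw [S.lex_count hc, S.lex_count hc2]



open Classical in
theorem kc_sum (W : ℂ → ℝ → ℝ) (hW : ∀ u s, W (-u) (-s) = - W u s) (K : Finset (ℂ × ℝ))
    (x : ℂ × ℝ) (h1 : x ∈ K) (h2 : -x ∈ K) :
    ∑ κ ∈ K, W κ.1 κ.2 * kc κ.1 κ.2 x.1 x.2 = 2 * W x.1 x.2 := by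
  have e : ∀ κ : ℂ × ℝ, kc κ.1 κ.2 x.1 x.2 = (if κ = x then 1 else 0) - (if κ = -x then 1 else 0) := by
    intro κ
    have a1 : (x.1 = κ.1 ∧ x.2 = κ.2) ↔ κ = x := by
      rw [Prod.ext_iff]; constructor <;> rintro ⟨h, h'⟩ <;> exact ⟨h.symm, h'.symm⟩
    have a2 : (x.1 = -κ.1 ∧ x.2 = -κ.2) ↔ κ = -x := by
      rw [Prod.ext_iff]; constructor <;> rintro ⟨h, h'⟩ <;> simp [h, h']
    simp only [kc, a1, a2]
  simp only [e, mul_sub, Finset.sum_sub_distrib, mul_ite, mul_one, mul_zero, Finset.sum_ite_eq', h1, h2, if_true]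
  have := hW x.1 x.2
  simp only [Prod.fst_neg, Prod.snd_neg, this]; ring

open Classical in
theorem balance_odd {N : ℕ} {B : Fin 3 → ℂ} {V : Fin N → Fin 3 → ℂ} (S : TileSys N B V)
    {L : Fin 3 → ℝ} {E : Fin 3 → ℂ} (hL : ∀ k, 0 < L k) (hE : ∀ k, ‖E k‖ = 1)
    (hB : ∀ k, B (k + 1) - B k = L k * E k)
    {l : Fin N → Fin 3 → ℝ} {d : Fin N → Fin 3 → ℂ} (hl : ∀ i k, 0 < l i k)
    (hd : ∀ i k, ‖d i k‖ = 1) (he : ∀ i k, V i (k + 1) - V i k = l i k * d i k)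
    (W : ℂ → ℝ → ℝ) (hW : ∀ u s, W (-u) (-s) = - W u s) :
    ∑ i, ∑ k, l i k * W (d i k) (crs (d i k) (V i k)) = ∑ k, L k * W (E k) (crs (E k) (B k)) := by
  set f : Fin N × Fin 3 → ℂ × ℝ := fun p => (d p.1 p.2, crs (d p.1 p.2) (V p.1 p.2)) with hf
  set g : Fin 3 → ℂ × ℝ := fun k => (E k, crs (E k) (B k)) with hg
  set K0 : Finset (ℂ × ℝ) := Finset.univ.image f ∪ Finset.univ.image g with hK0
  set K : Finset (ℂ × ℝ) := K0 ∪ K0.image (fun x => -x) with hK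
  have fK : ∀ p, f p ∈ K ∧ -f p ∈ K := by
    intro p
    have : f p ∈ K0 := by simp [hK0]
    constructor
    · exact Finset.mem_union_left _ this
    · exact Finset.mem_union_right _ (Finset.mem_image_of_mem _ this)
  have gK : ∀ p, g p ∈ K ∧ -g p ∈ K := by
    intro p
    have : g p ∈ K0 := Finset.mem_union_right _ (Finset.mem_image_of_mem _ (Finset.mem_univ _))
    constructor
    · exact Finset.mem_union_left _ this
    · exact Finset.mem_union_right _ (Finset.mem_image_of_mem _ this)
  have hu0 : ∀ κ ∈ K0, ‖κ.1‖ = 1 := by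
    intro κ hκ
    rcases Finset.mem_union.1 hκ with h | h
    · obtain ⟨p, _, rfl⟩ := Finset.mem_image.1 h; exact hd _ _
    · obtain ⟨p, _, rfl⟩ := Finset.mem_image.1 h; exact hE _
  have hu : ∀ κ ∈ K, ‖κ.1‖ = 1 := by
    intro κ hκ
    rcases Finset.mem_union.1 hκ with h | h
    · exact hu0 κ h
    · obtain ⟨p, hp, rfl⟩ := Finset.mem_image.1 h; simpa using hu0 p hp
  have key : ∑ κ ∈ K, W κ.1 κ.2 * (∑ i, ∑ k, l i k * kc κ.1 κ.2 (d i k) (crs (d i k) (V i k))) =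
      ∑ κ ∈ K, W κ.1 κ.2 * (∑ k, L k * kc κ.1 κ.2 (E k) (crs (E k) (B k))) :=
    Finset.sum_congr rfl (fun κ hκ => by rw [balance S hL hE hB hl hd he (hu κ hκ) κ.2])
  have A1 : ∑ κ ∈ K, W κ.1 κ.2 * (∑ i, ∑ k, l i k * kc κ.1 κ.2 (d i k) (crs (d i k) (V i k)))
      = ∑ i, ∑ k, l i k * (2 * W (d i k) (crs (d i k) (V i k))) := by
    simp only [Finset.mul_sum]
    rw [Finset.sum_comm]
    refine Finset.sum_congr rfl fun i _ => ?_
    rw [Finset.sum_comm]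
    refine Finset.sum_congr rfl fun k _ => ?_
    rw [← kc_sum W hW K (f (i, k)) (fK _).1 (fK _).2, Finset.mul_sum]
    refine Finset.sum_congr rfl fun κ _ => ?_
    simp only [hf]; ring
  have A2 : ∑ κ ∈ K, W κ.1 κ.2 * (∑ k, L k * kc κ.1 κ.2 (E k) (crs (E k) (B k)))
      = ∑ k, L k * (2 * W (E k) (crs (E k) (B k))) := by
    simp only [Finset.mul_sum]
    rw [Finset.sum_comm]
    refine Finset.sum_congr rfl fun k _ => ?_
    rw [← kc_sum W hW K (g k) (gK _).1 (gK _).2, Finset.mul_sum]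
    refine Finset.sum_congr rfl fun κ _ => ?_
    simp only [hg]; ring
  rw [A1, A2] at key
  have e1 : ∀ x y : ℝ, x * (2 * y) = 2 * (x * y) := fun x y => by ring
  simp only [e1, ← Finset.mul_sum] at key
  linarith

/-- `e^{iπ/3}` -/
def zt : ℂ := ⟨1 / 2, √3 / 2⟩

theorem sq3 : √3 * √3 = 3 := Real.mul_self_sqrt (by norm_num)
theorem zt_sq : zt ^ 2 = zt - 1 := by
  have := sq3
  apply Complex.ext <;> simp [zt, pow_two]
  · linarith
  · ring
theorem zt_cube : zt ^ 3 = -1 := by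
  have : zt ^ 3 = zt ^ 2 * zt := by ring
  rw [this, zt_sq]; linear_combination zt_sq
theorem zt_ne : zt ≠ 0 := by
  intro h; have := congrArg Complex.re h; simp [zt] at this
theorem zt_inv : zt⁻¹ = 1 - zt := by
  apply inv_eq_of_mul_eq_one_right
  linear_combination - zt_sq
theorem zt_norm : ‖zt‖ = 1 := by
  have h : ‖zt‖ ^ 6 = 1 := by
    rw [← norm_pow]; have : zt ^ 6 = (zt ^ 3) ^ 2 := by ring
    rw [this, zt_cube]; simp
  exact (pow_eq_one_iff_of_nonneg (norm_nonneg _) (by norm_num)).1 h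

def Bt (X : ℝ) : Fin 3 → ℂ := ![0, X, X * zt]

structure Setup (N : ℕ) (a b c X : ℝ) (ea eb : ℂ) (g : ℕ) (V : Fin N → Fin 3 → ℂ) : Prop where
  S : TileSys N (Bt X) V
  ha : 0 < a
  hb : 0 < b
  hc : 0 < c
  hX : 0 < X
  na : ‖ea‖ = 1
  nb : ‖eb‖ = 1
  hg : g = 1 ∨ g = 2
  tri : (c : ℂ) = a * eb⁻¹ + b * ea
  ang : ea * eb * zt ^ g = -1
  irr : ∀ n : ℤ, n ≠ 0 → ea ^ n ≠ 1
  tile : ∀ i, ∃ u : ℂ, ‖u‖ = 1 ∧ V i 1 = V i 0 + c * u ∧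
    (V i 2 = V i 0 + b * u * ea ∨ V i 2 = V i 0 + a * u * eb)

theorem unit_inv {e : ℂ} (h : ‖e‖ = 1) : e⁻¹ = (starRingEnd ℂ) e := by
  rw [Complex.inv_def, Complex.normSq_eq_norm_sq, h]; simp

theorem norm_ne {e : ℂ} (h : ‖e‖ = 1) : e ≠ 0 := by rintro rfl; simp at h

theorem zt_conj : (starRingEnd ℂ) zt = zt⁻¹ := (unit_inv zt_norm).symm

namespace Setup
variable {N : ℕ} {a b c X : ℝ} {ea eb : ℂ} {g : ℕ} {V : Fin N → Fin 3 → ℂ}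

theorem tri' (H : Setup N a b c X ea eb g V) : (c : ℂ) = b * ea⁻¹ + a * eb := by
  have := congrArg (starRingEnd ℂ) H.tri
  simp only [map_add, map_mul, Complex.conj_ofReal, map_inv₀] at this
  rw [← unit_inv H.na, ← unit_inv H.nb, inv_inv] at this
  rw [this]; ring

theorem irrb (H : Setup N a b c X ea eb g V) (n : ℤ) (hn : n ≠ 0) : eb ^ n ≠ 1 := by
  intro h
  have h1 : (ea * eb * zt ^ g) ^ (6 * n) = 1 := by
    rw [H.ang, zpow_mul]; norm_num
  have h2 : (zt ^ g) ^ (6 * n) = 1 := by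
    rw [zpow_mul]
    have : (zt ^ g) ^ (6 : ℤ) = 1 := by
      have : (zt ^ g) ^ (6 : ℤ) = (zt ^ 3) ^ (2 * g) := by
        norm_cast; rw [← pow_mul, ← pow_mul]; congr 1; ring
      rw [this, zt_cube, pow_mul]; simp
    rw [this, one_zpow]
  rw [mul_zpow, mul_zpow, h2] at h1
  have h3 : eb ^ (6 * n) = 1 := by rw [mul_comm, zpow_mul, h, one_zpow]
  rw [h3] at h1
  exact H.irr (6 * n) (by omega) (by simpa using h1)

theorem swap (H : Setup N a b c X ea eb g V) : Setup N b a c X eb ea g V where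
  S := H.S
  ha := H.hb
  hb := H.ha
  hc := H.hc
  hX := H.hX
  na := H.nb
  nb := H.na
  hg := H.hg
  tri := H.tri'
  ang := by rw [← H.ang]; ring
  irr := H.irrb
  tile i := by
    obtain ⟨u, h1, h2, h3⟩ := H.tile i
    exact ⟨u, h1, h2, h3.symm⟩

/-- edge description -/
theorem edges (H : Setup N a b c X ea eb g V) : ∃ (u : Fin N → ℂ) (s : Fin N → Prop),
    ∀ i, ‖u i‖ = 1 ∧ V i 1 - V i 0 = c * u i ∧
     ((s i ∧ V i 2 - V i 1 = a * (-(u i) * eb⁻¹) ∧ V i 0 - V i 2 = b * (-(u i) * ea)) ∨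
      (¬ s i ∧ V i 2 - V i 1 = b * (-(u i) * ea⁻¹) ∧ V i 0 - V i 2 = a * (-(u i) * eb))) := by
  choose u h1 h2 h3 using H.tile
  refine ⟨u, fun i => V i 2 = V i 0 + b * u i * ea, fun i => ⟨h1 i, by rw [h2]; ring, ?_⟩⟩
  by_cases hs : V i 2 = V i 0 + b * u i * ea
  · left
    refine ⟨hs, ?_, ?_⟩
    · rw [h2, hs]; linear_combination (-u i) * H.tri
    · rw [hs]; ring
  · right
    have hs' := (h3 i).resolve_left hs
    refine ⟨hs, ?_, ?_⟩
    · rw [h2, hs']; linear_combination (-u i) * H.tri'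
    · rw [hs']; ring

end Setup



theorem Bt_edge (X : ℝ) (k : Fin 3) : Bt X (k + 1) - Bt X k = X * zt ^ (2 * k.val) := by
  have h4 : zt ^ 4 = - zt := by linear_combination zt * zt_cube
  fin_cases k <;> simp [Bt]
  · rw [zt_sq]; ring
  · rw [h4]; ring

open Classical in
def llen (a b c : ℝ) (s : Prop) : Fin 3 → ℝ := ![c, if s then a else b, if s then b else a]
open Classical in
def ddir (ea eb u : ℂ) (s : Prop) : Fin 3 → ℂ :=
  ![u, if s then -u * eb⁻¹ else -u * ea⁻¹, if s then -u * ea else -u * eb]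

namespace Setup
variable {N : ℕ} {a b c X : ℝ} {ea eb : ℂ} {g : ℕ} {V : Fin N → Fin 3 → ℂ}

theorem edges' (H : Setup N a b c X ea eb g V) : ∃ (u : Fin N → ℂ) (s : Fin N → Prop),
    (∀ i, ‖u i‖ = 1) ∧ (∀ i k, 0 < llen a b c (s i) k) ∧ (∀ i k, ‖ddir ea eb (u i) (s i) k‖ = 1) ∧
    (∀ i k, V i (k + 1) - V i k = llen a b c (s i) k * ddir ea eb (u i) (s i) k) := by
  obtain ⟨u, s, h⟩ := H.edges
  refine ⟨u, s, fun i => (h i).1, ?_, ?_, ?_⟩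
  · intro i k
    have := H.ha; have := H.hb; have := H.hc
    fin_cases k <;> simp [llen] <;> first | assumption | (split_ifs <;> assumption)
  · intro i k
    have h1 := (h i).1; have h2 := H.na; have h3 := H.nb
    fin_cases k <;> simp [ddir] <;> first | assumption | (split_ifs <;> simp [h1, h2, h3])
  · intro i k
    obtain ⟨h1, h2, h3⟩ := h i
    rcases h3 with ⟨hs, h4, h5⟩ | ⟨hs, h4, h5⟩
    · fin_cases k
      · simpa [llen, ddir] using h2
      · simpa [llen, ddir, hs] using h4
      · simpa [llen, ddir, hs] using h5
    · fin_cases k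
      · simpa [llen, ddir] using h2
      · simpa [llen, ddir, hs] using h4
      · simpa [llen, ddir, hs] using h5

theorem bal (H : Setup N a b c X ea eb g V) {u : Fin N → ℂ} {s : Fin N → Prop}
    (h1 : ∀ i k, 0 < llen a b c (s i) k) (h2 : ∀ i k, ‖ddir ea eb (u i) (s i) k‖ = 1)
    (h3 : ∀ i k, V i (k + 1) - V i k = llen a b c (s i) k * ddir ea eb (u i) (s i) k)
    (W : ℂ → ℝ → ℝ) (hW : ∀ u s, W (-u) (-s) = - W u s) :
    ∑ i, ∑ k, llen a b c (s i) k * W (ddir ea eb (u i) (s i) k) (crs (ddir ea eb (u i) (s i) k) (V i k))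
     = ∑ k : Fin 3, X * W (zt ^ (2 * k.val)) (crs (zt ^ (2 * k.val)) (Bt X k)) :=
  balance_odd H.S (L := fun _ => X) (E := fun k => zt ^ (2 * k.val)) (fun _ => H.hX)
    (fun k => by rw [norm_pow, zt_norm, one_pow]) (Bt_edge X) h1 h2 h3 W hW

theorem im_ea (H : Setup N a b c X ea eb g V) : c * ea.im = a * (√3 / 2) := by
  have h1 : (c : ℂ) * ea⁻¹ = b * (ea⁻¹ * ea⁻¹) + a * (eb * ea⁻¹) := by rw [H.tri']; ring
  have na := norm_ne H.na
  have nb := norm_ne H.nb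
  have h2 : (c : ℂ) * ea⁻¹ = a * (ea * eb)⁻¹ + b := by
    rw [H.tri]; field_simp
  have h3 : (ea * eb)⁻¹ = - zt ^ g := by
    apply inv_eq_of_mul_eq_one_right
    linear_combination - H.ang
  rw [h3, unit_inv H.na] at h2
  have := congrArg Complex.im h2
  rcases H.hg with rfl | rfl
  · simp [zt] at this; linarith
  · rw [zt_sq] at this
    simp [zt] at this; linarith

theorem tile_area (H : Setup N a b c X ea eb g V) (i : Fin N) :
    lam (V i) 0 (V i 2) = a * b * (√3 / 2) := by
  obtain ⟨u, h1, h2, h3⟩ := H.tile i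
  have hu := unit_re_im h1
  rcases h3 with h3 | h3
  · have : lam (V i) 0 (V i 2) = b * (c * ea.im) := by
      simp [lam, h2, h3, crs]; linear_combination b * c * ea.im * hu
    rw [this, H.im_ea]; ring
  · have : lam (V i) 0 (V i 2) = a * (c * eb.im) := by
      simp [lam, h2, h3, crs]; linear_combination a * c * eb.im * hu
    rw [this, H.swap.im_ea]; ring

theorem area (H : Setup N a b c X ea eb g V) : X ^ 2 = N * (a * b) := by
  obtain ⟨u, s, h0, h1, h2, h3⟩ := H.edges'
  have := H.bal h1 h2 h3 (fun _ s => s) (fun _ s => rfl)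
  have e1 : ∀ i, ∑ k, llen a b c (s i) k * crs (ddir ea eb (u i) (s i) k) (V i k)
      = - lam (V i) 0 (V i 2) := by
    intro i
    simp only [← crs_smul_left, ← h3]
    simp [Fin.sum_univ_three, lam, crs]; ring
  have e2 : ∑ k : Fin 3, X * crs (zt ^ (2 * k.val)) (Bt X k) = - (X ^ 2 * (√3 / 2)) := by
    simp only [← crs_smul_left, ← Bt_edge]
    simp [Fin.sum_univ_three, crs, Bt, zt]; ring
  simp only [e1, e2, H.tile_area] at this
  simp at this
  have h4 : (0 : ℝ) < √3 := by positivity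
  have : (X ^ 2 - N * (a * b)) * √3 = 0 := by linarith
  rcases mul_eq_zero.1 this with h | h
  · linarith
  · linarith

theorem eb_eq (H : Setup N a b c X ea eb g V) : eb⁻¹ = - (ea * zt ^ g) := by
  apply inv_eq_of_mul_eq_one_right
  linear_combination - H.ang

theorem wsum (H : Setup N a b c X ea eb g V) {u : Fin N → ℂ} {s : Fin N → Prop}
    (h1 : ∀ i k, 0 < llen a b c (s i) k) (h2 : ∀ i k, ‖ddir ea eb (u i) (s i) k‖ = 1)
    (h3 : ∀ i k, V i (k + 1) - V i k = llen a b c (s i) k * ddir ea eb (u i) (s i) k)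
    (w : ℂ → ℤ) (e : ℤ) (he : e * e = 1) (w1 : w 1 = 1) (wz : ∀ z, w (zt * z) = - w z)
    (wt : ∀ z, w (ea * z) = e * w z) :
    ((∑ i, w (u i) : ℤ) : ℝ) * (if g = 1 then c - e * (a + b) else c + e * (a - b)) = 3 * X := by
  have wneg : ∀ z, w (-z) = - w z := by
    intro z
    have : -z = zt * (zt * (zt * z)) := by linear_combination (-z) * zt_cube
    rw [this, wz, wz, wz]; ring
  have wti : ∀ z, w (ea⁻¹ * z) = e * w z := by
    intro z
    have := wt (ea⁻¹ * z)
    rw [mul_inv_cancel_left₀ (norm_ne H.na)] at this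
    rw [this, ← mul_assoc, he, one_mul]
  have wzi : ∀ z, w (zt⁻¹ * z) = - w z := by
    intro z
    have := wz (zt⁻¹ * z)
    rw [mul_inv_cancel_left₀ zt_ne] at this
    omega
  have := H.bal h1 h2 h3 (fun z _ => (w z : ℝ)) (fun z _ => by rw [wneg]; push_cast; ring)
  have hebi := H.eb_eq
  have heb : eb = - (ea⁻¹ * (zt⁻¹) ^ g) := by
    rw [← inv_inv eb, hebi, inv_neg, mul_inv, inv_pow]
  have e1 : ∀ i, ∑ k, llen a b c (s i) k * (w (ddir ea eb (u i) (s i) k) : ℝ)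
      = (w (u i) : ℝ) * (if g = 1 then c - e * (a + b) else c + e * (a - b)) := by
    intro i
    by_cases hs : s i
    · simp only [Fin.sum_univ_three, llen, ddir, hs, if_true]
      simp only [Matrix.cons_val_zero, Matrix.cons_val_one, Matrix.cons_val]
      have r2 : w (-u i * ea) = - (e * w (u i)) := by
        rw [show -u i * ea = -(ea * u i) by ring, wneg, wt]
      rcases H.hg with rfl | rfl
      · have r1 : w (-u i * eb⁻¹) = - (e * w (u i)) := by
          rw [hebi, show -u i * -(ea * zt ^ 1) = zt * (ea * u i) by ring, wz, wt]
        rw [r1, r2]; push_cast; simp; ring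
      · have r1 : w (-u i * eb⁻¹) = (e * w (u i)) := by
          rw [hebi, show -u i * -(ea * zt ^ 2) = zt * (zt * (ea * u i)) by ring, wz, wz, wt]; ring
        rw [r1, r2]; push_cast; simp; ring
    · simp only [Fin.sum_univ_three, llen, ddir, hs, if_false]
      simp only [Matrix.cons_val_zero, Matrix.cons_val_one, Matrix.cons_val]
      have r2 : w (-u i * ea⁻¹) = - (e * w (u i)) := by
        rw [show -u i * ea⁻¹ = -(ea⁻¹ * u i) by ring, wneg, wti]
      rcases H.hg with rfl | rfl
      · have r1 : w (-u i * eb) = - (e * w (u i)) := by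
          rw [heb, show -u i * -(ea⁻¹ * zt⁻¹ ^ 1) = zt⁻¹ * (ea⁻¹ * u i) by ring, wzi, wti]
        rw [r1, r2]; push_cast; simp; ring
      · have r1 : w (-u i * eb) = (e * w (u i)) := by
          rw [heb, show -u i * -(ea⁻¹ * zt⁻¹ ^ 2) = zt⁻¹ * (zt⁻¹ * (ea⁻¹ * u i)) by ring, wzi, wzi, wti]; ring
        rw [r1, r2]; push_cast; simp; ring
  have q2 : w (zt ^ 2) = 1 := by
    rw [show zt ^ 2 = zt * (zt * 1) by ring, wz, wz, w1]; ring
  have q4 : w (zt ^ 4) = 1 := by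
    rw [show zt ^ 4 = zt * (zt * (zt ^ 2)) by ring, wz, wz, q2]; ring
  have e2 : ∑ k : Fin 3, X * (w (zt ^ (2 * k.val)) : ℝ) = 3 * X := by
    simp [Fin.sum_univ_three, q2, q4, w1]; ring
  rw [e2] at this
  simp only [e1, ← Finset.sum_mul] at this
  push_cast
  exact this

end Setup

/-! the weight -/
open Classical in
def wt (ea : ℂ) (e : ℤˣ) (z : ℂ) : ℤ :=
  if h : ∃ p : ℤ × ℤ, z = ea ^ p.1 * zt ^ p.2 then
    (((-1) ^ h.choose.2 * e ^ h.choose.1 : ℤˣ) : ℤ) else 0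

theorem zt_zpow6 (n : ℤ) : zt ^ (6 * n) = 1 := by
  rw [zpow_mul]
  have : zt ^ (6 : ℤ) = 1 := by
    have : zt ^ (6 : ℤ) = (zt ^ 3) ^ 2 := by norm_cast; ring
    rw [this, zt_cube]; norm_num
  rw [this, one_zpow]

theorem zt_even {m : ℤ} (h : zt ^ m = 1) : Even m := by
  have h3 : zt ^ (3 : ℤ) = -1 := by exact_mod_cast zt_cube
  have : (zt ^ (3 : ℤ)) ^ m = 1 := by rw [← zpow_mul, mul_comm, zpow_mul, h, one_zpow]
  rw [h3] at this
  by_contra hm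
  rw [Int.not_even_iff_odd] at hm
  rw [hm.neg_one_zpow] at this
  norm_num at this

theorem wt_spec {ea : ℂ} (h0 : ea ≠ 0) (hirr : ∀ n : ℤ, n ≠ 0 → ea ^ n ≠ 1) (e : ℤˣ) (j m : ℤ) :
    wt ea e (ea ^ j * zt ^ m) = (((-1) ^ m * e ^ j : ℤˣ) : ℤ) := by
  have h : ∃ p : ℤ × ℤ, ea ^ j * zt ^ m = ea ^ p.1 * zt ^ p.2 := ⟨(j, m), rfl⟩
  rw [wt, dif_pos h]
  set p := h.choose with hp
  have hs : ea ^ j * zt ^ m = ea ^ p.1 * zt ^ p.2 := h.choose_spec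
  have h6 : ea ^ (6 * (j - p.1)) = 1 := by
    have h7 : ea ^ (j - p.1) = zt ^ (p.2 - m) := by
      rw [zpow_sub₀ h0, zpow_sub₀ zt_ne, div_eq_div_iff (zpow_ne_zero _ h0) (zpow_ne_zero _ zt_ne)]
      rw [hs]; ring
    rw [mul_comm, zpow_mul, h7, ← zpow_mul, mul_comm, zt_zpow6]
  have hj : j = p.1 := by
    by_contra hne
    exact hirr _ (by omega) h6
  rw [← hj] at hs
  have hs2 : zt ^ m = zt ^ p.2 := mul_left_cancel₀ (zpow_ne_zero _ h0) hs
  have hs3 : zt ^ (m - p.2) = 1 := by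
    rw [zpow_sub₀ zt_ne, hs2, div_self (zpow_ne_zero _ zt_ne)]
  have hev := zt_even hs3
  rw [← hj]
  have : (-1 : ℤˣ) ^ m = (-1) ^ p.2 := by
    rw [show m = (m - p.2) + p.2 by ring, zpow_add, hev.neg_one_zpow, one_mul]
  rw [this]

theorem wt_none {ea : ℂ} {e : ℤˣ} {z : ℂ} (h : ¬ ∃ p : ℤ × ℤ, z = ea ^ p.1 * zt ^ p.2) :
    wt ea e z = 0 := by
  rw [wt, dif_neg h]

theorem wt_props {ea : ℂ} (h0 : ea ≠ 0) (hirr : ∀ n : ℤ, n ≠ 0 → ea ^ n ≠ 1) (e : ℤˣ) :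
    wt ea e 1 = 1 ∧ (∀ z, wt ea e (zt * z) = - wt ea e z) ∧ (∀ z, wt ea e (ea * z) = e * wt ea e z)
    ∧ (∀ z, wt ea e z ≤ 1 ∧ -1 ≤ wt ea e z) := by
  refine ⟨?_, ?_, ?_, ?_⟩
  · have := wt_spec h0 hirr e 0 0
    simpa using this
  · intro z
    by_cases h : ∃ p : ℤ × ℤ, z = ea ^ p.1 * zt ^ p.2
    · obtain ⟨⟨j, m⟩, rfl⟩ := h
      rw [show zt * (ea ^ j * zt ^ m) = ea ^ j * zt ^ (m + 1) by rw [zpow_add_one₀ zt_ne]; ring]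
      rw [wt_spec h0 hirr, wt_spec h0 hirr, zpow_add_one]
      simp
    · rw [wt_none h, wt_none]
      · simp
      · rintro ⟨⟨j, m⟩, hz⟩
        apply h
        refine ⟨(j, m - 1), ?_⟩
        simp only at hz ⊢
        rw [zpow_sub_one₀ zt_ne, ← mul_assoc, ← hz]
        field_simp [zt_ne]
  · intro z
    by_cases h : ∃ p : ℤ × ℤ, z = ea ^ p.1 * zt ^ p.2
    · obtain ⟨⟨j, m⟩, rfl⟩ := h
      rw [show ea * (ea ^ j * zt ^ m) = ea ^ (j + 1) * zt ^ m by rw [zpow_add_one₀ h0]; ring]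
      rw [wt_spec h0 hirr, wt_spec h0 hirr, zpow_add_one]
      push_cast; ring
    · rw [wt_none h, wt_none]
      · simp
      · rintro ⟨⟨j, m⟩, hz⟩
        apply h
        refine ⟨(j - 1, m), ?_⟩
        simp only at hz ⊢
        rw [zpow_sub_one₀ h0, mul_right_comm, ← hz]
        field_simp
  · intro z
    by_cases h : ∃ p : ℤ × ℤ, z = ea ^ p.1 * zt ^ p.2
    · obtain ⟨⟨j, m⟩, rfl⟩ := h
      rw [wt_spec h0 hirr]
      rcases Int.units_eq_one_or ((-1) ^ m * e ^ j : ℤˣ) with h | h <;> rw [h] <;> simp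
    · rw [wt_none h]; simp

theorem wt_parity {ea : ℂ} (h0 : ea ≠ 0) (hirr : ∀ n : ℤ, n ≠ 0 → ea ^ n ≠ 1) (z : ℂ) :
    (2 : ℤ) ∣ wt ea 1 z - wt ea (-1) z := by
  by_cases h : ∃ p : ℤ × ℤ, z = ea ^ p.1 * zt ^ p.2
  · obtain ⟨⟨j, m⟩, rfl⟩ := h
    rw [wt_spec h0 hirr, wt_spec h0 hirr]
    rcases Int.units_eq_one_or ((-1) ^ m * 1 ^ j : ℤˣ) with h | h <;>
    rcases Int.units_eq_one_or ((-1) ^ m * (-1) ^ j : ℤˣ) with h' | h' <;> rw [h, h'] <;> simp <;> norm_num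
  · rw [wt_none h, wt_none h]; simp



theorem clo_vert {V : Fin 3 → ℂ} (hV : 0 < lam V 0 (V 2)) (m : Fin 3) : CloIn V (V m) := by
  intro k
  unfold lam crs at hV
  fin_cases k <;> fin_cases m <;> simp [lam, crs] at hV ⊢ <;> nlinarith

theorem lam_Bt (X : ℝ) (k : Fin 3) (z : ℂ) :
    lam (Bt X) k z = X * (crs (zt ^ (2 * k.val)) z - crs (zt ^ (2 * k.val)) (Bt X k)) := by
  rw [lam, Bt_edge, crs_smul_left]
  simp only [crs, Complex.sub_re, Complex.sub_im]; ring

theorem zt_pw (k k0 : Fin 3) : zt ^ (2 * k.val) ≠ - zt ^ (2 * k0.val) ∧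
    (zt ^ (2 * k.val) = zt ^ (2 * k0.val) → k = k0) := by
  have z4 : zt ^ 4 = - zt := by linear_combination zt * zt_cube
  have hs : 0 < √3 := by positivity
  have f : ∀ k : Fin 3, zt ^ (2 * k.val) = ![⟨1, 0⟩, ⟨-1/2, √3/2⟩, ⟨-1/2, -(√3/2)⟩] k := by
    intro k
    fin_cases k
    · simp [Complex.ext_iff]
    · simp [zt_sq]; simp [zt, Complex.ext_iff]; norm_num
    · simp [z4]; simp [zt, Complex.ext_iff]; norm_num
  rw [f, f]
  fin_cases k <;> fin_cases k0 <;> simp [Complex.ext_iff] <;> norm_num <;> intros <;> linarith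

theorem par_unit {u d : ℂ} (hu : ‖u‖ = 1) (hd : ‖d‖ = 1) (h : crs u d = 0) : d = u ∨ d = -u := by
  have h1 := unit_re_im hu
  have h2 := unit_re_im hd
  unfold crs at h
  set t := u.re * d.re + u.im * d.im with ht
  have e1 : d.re = t * u.re := by
    rw [ht]; linear_combination (-d.re) * h1 - u.im * h
  have e2 : d.im = t * u.im := by
    rw [ht]; linear_combination (-d.im) * h1 + u.re * h
  have h3 : t * t = 1 := by
    rw [e1, e2] at h2; linear_combination h2 - t * t * h1
  rcases mul_self_eq_one_iff.1 h3 with h4 | h4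
  · left; apply Complex.ext <;> simp [e1, e2, h4]
  · right; apply Complex.ext <;> simp [e1, e2, h4]

namespace Setup
variable {N : ℕ} {a b c X : ℝ} {ea eb : ℂ} {g : ℕ} {V : Fin N → Fin 3 → ℂ}

theorem inB (H : Setup N a b c X ea eb g V) (i : Fin N) (m : Fin 3) : CloIn (Bt X) (V i m) :=
  (H.S.cov _).2 ⟨i, clo_vert (H.S.posV i) m⟩

theorem no_opp (H : Setup N a b c X ea eb g V) {i : Fin N} {k k0 : Fin 3} {l : ℝ} {d : ℂ}
    (hl : 0 < l) (he : V i (k + 1) - V i k = l * d) (hd : d = - zt ^ (2 * k0.val))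
    (h0 : lam (Bt X) k0 (V i k) = 0) : False := by
  have h1 := H.inB i (k + 2) k0
  have h2 := H.S.posV i
  rw [← lam_cyc _ k, lam, he, crs_smul_left] at h2
  have h3 := pos_of_mul_pos_right h2 hl.le
  have hX := H.hX
  rw [lam_Bt] at h1 h0
  have h4 : crs d (V i (k + 2) - V i k) = crs (zt ^ (2 * k0.val)) (V i k) - crs (zt ^ (2 * k0.val)) (V i (k + 2)) := by
    rw [hd]; simp only [crs, Complex.neg_re, Complex.neg_im, Complex.sub_re, Complex.sub_im]; ring
  rw [h4] at h3
  nlinarith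

open Classical in
theorem bdry (H : Setup N a b c X ea eb g V) {u : Fin N → ℂ} {s : Fin N → Prop}
    (h1 : ∀ i k, 0 < llen a b c (s i) k) (h2 : ∀ i k, ‖ddir ea eb (u i) (s i) k‖ = 1)
    (h3 : ∀ i k, V i (k + 1) - V i k = llen a b c (s i) k * ddir ea eb (u i) (s i) k) (k0 : Fin 3) :
    ∃ p q r : ℕ, X = p * a + q * b + r * c ∧ (r ≠ 0 → ∃ i, u i = zt ^ (2 * k0.val)) ∧
      (p = 0 → q = 0 → ∀ i m, m ≠ 0 →
        ¬ (lam (Bt X) k0 (V i m) = 0 ∧ lam (Bt X) k0 (V i (m + 1)) = 0)) := by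
  set U := zt ^ (2 * k0.val) with hU
  have nU : ‖U‖ = 1 := by rw [hU, norm_pow, zt_norm, one_pow]
  have B0 := balance H.S (L := fun _ => X) (E := fun k => zt ^ (2 * k.val)) (fun _ => H.hX)
    (fun k => by rw [norm_pow, zt_norm, one_pow]) (Bt_edge X) h1 h2 h3 nU (crs U (Bt X k0))
  have hX := H.hX
  obtain ⟨I, hI⟩ : ∃ I : Fin N → Fin 3 → Prop, ∀ i k, I i k ↔ (ddir ea eb (u i) (s i) k = U ∧
    crs (ddir ea eb (u i) (s i) k) (V i k) = crs U (Bt X k0)) := ⟨_, fun _ _ => Iff.rfl⟩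
  have L1 : ∀ i k, kc U (crs U (Bt X k0)) (ddir ea eb (u i) (s i) k) (crs (ddir ea eb (u i) (s i) k) (V i k))
      = if I i k then 1 else 0 := by
    intro i k
    unfold kc
    rw [if_neg (c := _ = -U ∧ _), sub_zero]
    · simp only [hI]
    rintro ⟨e1, e2⟩
    apply H.no_opp (h1 i k) (h3 i k) e1
    rw [lam_Bt]
    rw [e1] at e2
    have : crs (-U) (V i k) = - crs U (V i k) := by simp [crs]; ring
    rw [this] at e2
    rw [← hU]; rw [neg_inj.1 e2]; simp
  have L2 : ∀ k : Fin 3, kc U (crs U (Bt X k0)) (zt ^ (2 * k.val)) (crs (zt ^ (2 * k.val)) (Bt X k))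
      = if k = k0 then 1 else 0 := by
    intro k
    unfold kc
    rw [if_neg (c := _ = -U ∧ _), sub_zero]
    · by_cases hk : k = k0
      · subst hk; simp [hU]
      · rw [if_neg, if_neg hk]
        rintro ⟨h, _⟩
        exact hk ((zt_pw k k0).2 h)
    · rintro ⟨h, _⟩
      exact (zt_pw k k0).1 h
  simp only [L1, L2, mul_ite, mul_one, mul_zero, Finset.sum_ite_eq', Finset.mem_univ, if_true] at B0
  refine ⟨∑ i, ((if I i 1 ∧ s i then 1 else 0) + (if I i 2 ∧ ¬ s i then 1 else 0)),
    ∑ i, ((if I i 1 ∧ ¬ s i then 1 else 0) + (if I i 2 ∧ s i then 1 else 0)),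
    ∑ i, (if I i 0 then 1 else 0), ?_, ?_, ?_⟩
  · refine B0.symm.trans ?_
    push_cast
    simp only [Finset.sum_mul, ← Finset.sum_add_distrib]
    refine Finset.sum_congr rfl fun i _ => ?_
    rw [Fin.sum_univ_three]
    by_cases hs : s i <;> by_cases i0 : I i 0 <;> by_cases i1 : I i 1 <;> by_cases i2 : I i 2 <;>
      simp [hs, i0, i1, i2, llen] <;> ring
  · intro hr
    by_contra hcon
    push Not at hcon
    apply hr
    apply Finset.sum_eq_zero
    intro i _
    rw [if_neg]
    rw [hI]
    rintro ⟨h, _⟩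
    exact hcon i h
  · intro hp hq i m hm ⟨e1, e2⟩
    simp only [Finset.sum_eq_zero_iff, Finset.mem_univ, true_implies, Nat.add_eq_zero_iff,
      ite_eq_right_iff, one_ne_zero] at hp hq
    have hp := hp i
    have hq := hq i
    have hnI : ¬ I i m := by
      intro h
      fin_cases m
      · exact hm rfl
      · by_cases hs : s i
        · exact hp.1 ⟨h, hs⟩
        · exact hq.1 ⟨h, hs⟩
      · by_cases hs : s i
        · exact hq.2 ⟨h, hs⟩
        · exact hp.2 ⟨h, hs⟩
    have e3 : crs U (V i m) = crs U (Bt X k0) := by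
      rw [lam_Bt, ← hU] at e1
      rcases mul_eq_zero.1 e1 with h | h <;> linarith
    have e4 : crs U (V i (m + 1)) = crs U (Bt X k0) := by
      rw [lam_Bt, ← hU] at e2
      rcases mul_eq_zero.1 e2 with h | h <;> linarith
    have e5 : crs U (ddir ea eb (u i) (s i) m) = 0 := by
      have : crs U (V i (m + 1) - V i m) = 0 := by
        have : crs U (V i (m + 1) - V i m) = crs U (V i (m + 1)) - crs U (V i m) := by
          simp only [crs, Complex.sub_re, Complex.sub_im]; ring
        rw [this, e3, e4, sub_self]
      rw [h3, crs_smul_right] at this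
      exact (mul_eq_zero.1 this).resolve_left (h1 i m).ne'
    rcases par_unit nU (h2 i m) e5 with h | h
    · exact hnI ((hI _ _).2 ⟨h, by rw [h]; exact e3⟩)
    · exact H.no_opp (h1 i m) (h3 i m) h e1
end Setup



set_option synthInstance.maxHeartbeats 400000 in
set_option synthInstance.maxSize 4000 in
theorem fin_check1 : ∀ A < 40, ∀ B < A, (3 ≤ B ∧ (A * B) % 3 = 0 ∧ A % 2 = B % 2 ∧ A * B < 120 ∧
    A ≤ A * B / 3 ∧ 16 * (A * B / 3) < (A + B) * (A + B)) →
    (A = 18 ∧ B = 4) ∨ ((∀ k < 80, k * k ≠ (A + B) * (A + B) - 16 * (A * B / 3)) ∧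
     (∀ p < 80, ∀ r < 80, p * (A + B) + r * (A - B) = 2 * (A * B / 3) → A = A * B / 3 ∧ r ≠ 0)) := by
  decide +kernel

set_option synthInstance.maxHeartbeats 400000 in
set_option synthInstance.maxSize 4000 in
theorem fin_check2 : ∀ A < 40, ∀ B < A, (3 ≤ B ∧ (A * B) % 3 = 0 ∧ A % 2 = B % 2 ∧ A * B < 120 ∧
    A ≤ A * B / 3) →
    (A = 9 ∧ B = 5) ∨ ((∀ k < 80, k * k ≠ (A - B) * (A - B) + 16 * (A * B / 3)) ∧
     (∀ r < 80, r * (A + B) = 2 * (A * B / 3) → (A = 12 ∧ B = 4) ∨ (A = 18 ∧ B = 6))) := by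
  decide +kernel

theorem irr_nat {D : ℕ} (hD : D ≤ 6320) (h : ∀ k < 80, k * k ≠ D) {x y : ℤ} (e : x * √(D : ℝ) = y) : x = 0 := by
  by_contra hx
  have : Irrational √(D : ℝ) := by
    rw [irrational_sqrt_natCast_iff]
    rintro ⟨k, hk⟩
    refine h k ?_ hk.symm
    by_contra hk2
    have : 80 * 80 ≤ k * k := Nat.mul_le_mul (by omega) (by omega)
    omega
  apply this
  refine ⟨(y / x : ℚ), ?_⟩
  push_cast
  rw [← e]
  have : (x : ℝ) ≠ 0 := by exact_mod_cast hx
  field_simp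

namespace Setup
variable {N : ℕ} {a b c X : ℝ} {ea eb : ℂ} {g : ℕ} {V : Fin N → Fin 3 → ℂ}

theorem cosl (H : Setup N a b c X ea eb g V) :
    c ^ 2 = a ^ 2 + b ^ 2 + (if g = 1 then -1 else 1) * (a * b) := by
  have h1 := H.tri
  have h2 := H.tri'
  have h3 := H.eb_eq
  have h5 := H.swap.eb_eq
  have na := norm_ne H.na
  have nb := norm_ne H.nb
  have h4 : (c : ℂ) ^ 2 = a ^ 2 + b ^ 2 + a * b * (- zt ^ g - (zt⁻¹) ^ g) := by
    have e1 : ea⁻¹ * eb⁻¹ = - zt ^ g := by rw [h3]; field_simp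
    have e2 : ea * eb = - (zt⁻¹) ^ g := by
      rw [← inv_inv (ea * eb), mul_inv, e1, inv_neg, inv_pow]
    calc (c : ℂ) ^ 2 = (a * eb⁻¹ + b * ea) * (b * ea⁻¹ + a * eb) := by rw [← h1, ← h2]; ring
      _ = a ^ 2 * (eb⁻¹ * eb) + b ^ 2 * (ea * ea⁻¹) + a * b * (ea⁻¹ * eb⁻¹ + ea * eb) := by ring
      _ = _ := by rw [e1, e2, inv_mul_cancel₀ nb, mul_inv_cancel₀ na]; ring
  rcases H.hg with rfl | rfl
  · have : - zt ^ 1 - (zt⁻¹) ^ 1 = -1 := by rw [zt_inv]; ring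
    rw [this] at h4
    simp only [if_true]
    have h6 : c ^ 2 = a ^ 2 + b ^ 2 + a * b * (-1 : ℝ) := by exact_mod_cast h4
    rw [h6]; ring
  · have : - zt ^ 2 - (zt⁻¹) ^ 2 = 1 := by rw [zt_inv]; linear_combination (-2) * zt_sq
    rw [this] at h4
    simp only [OfNat.ofNat_ne_one, if_false]
    rw [one_mul]
    rw [mul_one] at h4
    exact_mod_cast h4

theorem ne_ab (H : Setup N a b c X ea eb g V) : a ≠ b := by
  intro hab
  have h1 := H.tri
  have h2 := H.tri'
  have na := norm_ne H.na
  have nb := norm_ne H.nb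
  subst hab
  have ha : (a : ℂ) ≠ 0 := by exact_mod_cast H.ha.ne'
  have e1 : eb⁻¹ + ea = ea⁻¹ + eb := by
    apply mul_left_cancel₀ ha
    linear_combination h2 - h1
  have e2 : (ea - eb) * (ea * eb + 1) = 0 := by
    field_simp at e1
    linear_combination e1
  rcases mul_eq_zero.1 e2 with h | h
  · have h : ea = eb := sub_eq_zero.1 h
    have h3 := H.ang
    rw [← h] at h3
    apply H.irr 12 (by norm_num)
    have h6 : zt ^ 6 = 1 := by
      have : zt ^ 6 = (zt ^ 3) ^ 2 := by ring
      rw [this, zt_cube]; norm_num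
    have : ea ^ (12 : ℤ) * (zt ^ 6) ^ g = (ea * ea * zt ^ g) ^ 6 := by
      norm_cast; ring
    rw [h3, h6, one_pow, mul_one] at this
    rw [this]; norm_num
  · have h3 := H.ang
    have h4 : ea * eb = -1 := by linear_combination h
    rw [h4] at h3
    have := zt_sq
    rcases H.hg with rfl | rfl
    · have h5 := congrArg Complex.im h3
      simp [zt] at h5
    · rw [zt_sq] at h3
      have h5 := congrArg Complex.im h3
      simp [zt] at h5

/-- the two coloring numbers -/
theorem colors (H : Setup N a b c X ea eb g V) {u : Fin N → ℂ} {s : Fin N → Prop}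
    (h1 : ∀ i k, 0 < llen a b c (s i) k) (h2 : ∀ i k, ‖ddir ea eb (u i) (s i) k‖ = 1)
    (h3 : ∀ i k, V i (k + 1) - V i k = llen a b c (s i) k * ddir ea eb (u i) (s i) k) :
    ∃ K L : ℤ, |K| ≤ N ∧ |L| ≤ N ∧ 2 ∣ K - L ∧
     (K : ℝ) * (if g = 1 then c - (a + b) else c + (a - b)) = 3 * X ∧
     (L : ℝ) * (if g = 1 then c + (a + b) else c - (a - b)) = 3 * X ∧
     (K = -N → ∀ i, u i ≠ 1) := by
  have na := norm_ne H.na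
  obtain ⟨p1, p2, p3, p4⟩ := wt_props na H.irr 1
  obtain ⟨q1, q2, q3, q4⟩ := wt_props na H.irr (-1)
  have bnd : ∀ w : ℂ → ℤ, (∀ z, w z ≤ 1 ∧ -1 ≤ w z) → |∑ i, w (u i)| ≤ N := by
    intro w hw
    rw [abs_le]
    constructor
    · have := Finset.sum_le_sum (fun i (_ : i ∈ Finset.univ) => (hw (u i)).2)
      simpa using this
    · have := Finset.sum_le_sum (fun i (_ : i ∈ Finset.univ) => (hw (u i)).1)
      simpa using this
  refine ⟨∑ i, wt ea 1 (u i), ∑ i, wt ea (-1) (u i), bnd _ p4, bnd _ q4, ?_, ?_, ?_, ?_⟩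
  · rw [← Finset.sum_sub_distrib]
    exact Finset.dvd_sum fun i _ => wt_parity na H.irr _
  · have := H.wsum h1 h2 h3 (wt ea 1) 1 (by norm_num) p1 p2 (by simpa using p3)
    rw [← this]; simp
  · have := H.wsum h1 h2 h3 (wt ea (-1)) (-1) (by norm_num) q1 q2 (by simpa using q3)
    rw [← this]; congr 1; push_cast; congr 1 <;> ring
  · intro hK i hi
    have hlt : ∑ i : Fin N, (-1 : ℤ) < ∑ i, wt ea 1 (u i) := by
      apply Finset.sum_lt_sum (fun i _ => (p4 (u i)).2)
      exact ⟨i, Finset.mem_univ _, by rw [hi, p1]; norm_num⟩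
    simp at hlt
    omega

end Setup



theorem prod_aux {N : ℕ} {A B : ℤ} {P Q a b X : ℝ} (hP : 0 < P) (hQ : 0 < Q) (ha : 0 < a) (hb : 0 < b)
    (hX : 0 < X) (h1 : A * P = 3 * X) (h2 : B * Q = 3 * X) (h3 : P * Q = 3 * (a * b))
    (h4 : X ^ 2 = N * (a * b)) (hA : |A| ≤ N) (hB : |B| ≤ N) :
    ∃ (A' B' : ℕ) (t : ℝ), (A' : ℤ) = A ∧ (B' : ℤ) = B ∧ 0 < t ∧ A' * B' = 3 * N ∧ 3 ≤ A' ∧ 3 ≤ B' ∧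
      A' ≤ N ∧ B' ≤ N ∧ P = 2 * B' * t ∧ Q = 2 * A' * t ∧ X = 2 * N * t ∧ a * b = 4 * N * t ^ 2 := by
  have hab := mul_pos ha hb
  have e : (A * B : ℤ) = 3 * N := by
    have : (A : ℝ) * B = 3 * N := by
      have : ((A : ℝ) * B - 3 * N) * (a * b) = 0 := by
        linear_combination (1/3 : ℝ) * (B * Q * h1 + 3 * X * h2) - (1/3 : ℝ) * A * B * h3 + 3 * h4
      rcases mul_eq_zero.1 this with h | h <;> linarith
    exact_mod_cast this
  have pA : 0 < A := by
    have : (0 : ℝ) < A := by by_contra hh; push Not at hh; nlinarith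
    exact_mod_cast this
  have pB : 0 < B := by
    have : (0 : ℝ) < B := by by_contra hh; push Not at hh; nlinarith
    exact_mod_cast this
  rw [abs_of_pos pA] at hA
  rw [abs_of_pos pB] at hB
  obtain ⟨A, rfl⟩ := Int.eq_ofNat_of_zero_le pA.le
  obtain ⟨B, rfl⟩ := Int.eq_ofNat_of_zero_le pB.le
  have hN : 0 < N := by omega
  have hNr : (0 : ℝ) < N := by exact_mod_cast hN
  have er : (A : ℝ) * B = 3 * N := by exact_mod_cast e
  have hAr : (0 : ℝ) < A := by exact_mod_cast pA
  have hBr : (0 : ℝ) < B := by exact_mod_cast pB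
  push_cast at h1 h2
  refine ⟨A, B, X / (2 * N), rfl, rfl, by positivity, by exact_mod_cast e, ?_, ?_, by omega, by omega, ?_, ?_, ?_, ?_⟩
  · by_contra hh
    have : (A : ℤ) ≤ 2 := by omega
    nlinarith
  · by_contra hh
    have : (B : ℤ) ≤ 2 := by omega
    nlinarith
  · field_simp
    have : (3 : ℝ) * (P * N - B * X) = 0 := by linear_combination B * h1 - P * er
    linarith
  · field_simp
    have : (3 : ℝ) * (Q * N - A * X) = 0 := by linear_combination A * h2 - Q * er
    linarith
  · field_simp
  · field_simp
    rw [h4]; ring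

theorem sqn (n : ℕ) : √((n ^ 2 : ℕ) : ℝ) = n := by
  rw [Nat.cast_pow]; exact Real.sqrt_sq (by positivity)
theorem sqn5 (n : ℕ) : √((n ^ 2 * 5 : ℕ) : ℝ) = n * √5 := by
  rw [Nat.cast_mul, Real.sqrt_mul (by positivity), sqn]; norm_num

namespace Setup
variable {N : ℕ} {a b c X : ℝ} {ea eb : ℂ} {g : ℕ} {V : Fin N → Fin 3 → ℂ}

def Hbc (X : ℝ) (V : Fin N → Fin 3 → ℂ) : Prop := ∀ k0 i m, m ≠ 0 →
        ¬ (lam (Bt X) k0 (V i m) = 0 ∧ lam (Bt X) k0 (V i (m + 1)) = 0)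

theorem reduce_lt (H : Setup N a b c X ea eb g V) (hN : N < 40) (hlt : a < b) : ∃ κ : ℝ, 0 < κ ∧
    ((g = 2 ∧ a = κ * 3 ∧ b = κ * 5 ∧ c = κ * 7 ∧ X = κ * 15) ∨
     (g = 1 ∧ a = κ * 3 ∧ b = κ * 8 ∧ c = κ * 7 ∧ X = κ * 24) ∨
     (g = 2 ∧ a = κ * (√5 - 1) ∧ b = κ * (√5 + 1) ∧ c = κ * 4 ∧ (X = κ * 8 ∨ X = κ * 12) ∧ Hbc X V)) := by
  obtain ⟨u, s, h0, h1, h2, h3⟩ := H.edges'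
  have hbd := H.bdry h1 h2 h3
  obtain ⟨K, L, hK, hL, hKL, eK, eL, hr⟩ := H.colors h1 h2 h3
  have ha := H.ha; have hb := H.hb; have hc := H.hc; have hX := H.hX
  have hab := mul_pos ha hb
  have hcos := H.cosl
  have harea := H.area
  rcases H.hg with rfl | rfl
  · simp only [if_true] at eK eL hcos
    have hP : 0 < a + b - c := by nlinarith
    obtain ⟨A, B, t, hA, hB, ht, hAB, A3, B3, AN, BN, eP, eQ, eX, eab⟩ := prod_aux (A := -K) (B := L) hP (by positivity : 0 < a + b + c)
      ha hb hX (by push_cast; linear_combination eK) (by linear_combination eL) (by nlinarith) harea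
      (by rwa [abs_neg]) hL
    have BA : B < A := by
      have : (0 : ℝ) < t * (A - B) := by nlinarith
      have := pos_of_mul_pos_right this ht.le
      have : (B : ℝ) < A := by linarith
      exact_mod_cast this
    have es : a + b = t * (A + B) := by linear_combination (1/2 : ℝ) * (eP + eQ)
    have ec : c = t * (A - B) := by linear_combination (1/2 : ℝ) * (eQ - eP)
    have hD : 16 * N < (A + B) * (A + B) := by
      have h5 : (b - a) ^ 2 = t ^ 2 * ((A + B) * (A + B) - 16 * N) := by
        linear_combination ((a + b) + t * (A + B)) * es - 4 * eab
      have h6 : 0 < (b - a) ^ 2 := by have := sub_pos.2 hlt; positivity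
      rw [h5] at h6
      have := pos_of_mul_pos_right h6 (by positivity)
      have : (16 : ℝ) * N < (A + B) * (A + B) := by linarith
      exact_mod_cast this
    have N3 : A * B / 3 = N := by omega
    have fc := fin_check1 A (by omega) B BA (by rw [N3]; refine ⟨B3, by omega, by omega, by omega, AN, hD⟩)
    rw [N3] at fc
    obtain ⟨D, hDe⟩ : ∃ D : ℕ, (A + B) * (A + B) = D + 16 * N := ⟨_, (Nat.sub_add_cancel hD.le).symm⟩
    have hDr : ((A : ℝ) + B) * (A + B) = D + 16 * N := by exact_mod_cast hDe
    have eD : b - a = t * √D := by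
      have h5 : (b - a) ^ 2 = t ^ 2 * D := by
        linear_combination ((a + b) + t * (A + B)) * es - 4 * eab + t ^ 2 * hDr
      rw [← abs_of_pos (sub_pos.2 hlt), ← Real.sqrt_sq_eq_abs, h5, Real.sqrt_mul (by positivity), Real.sqrt_sq ht.le]
    rcases fc with ⟨rfl, rfl⟩ | ⟨f1, f2⟩
    · have hN' : N = 24 := by omega
      subst hN'
      have hD2 : D = 10 ^ 2 := by omega
      rw [hD2, sqn] at eD
      push_cast at eD es ec eX
      refine ⟨2 * t, by positivity, Or.inr (Or.inl ⟨rfl, ?_, ?_, ?_, ?_⟩)⟩ <;> linarith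
    · exfalso
      have : (A + B) * (A + B) - 16 * N = D := by omega
      rw [this] at f1
      have Dle : D ≤ 6320 := by
        have : (A + B) * (A + B) ≤ 78 * 78 := Nat.mul_le_mul (by omega) (by omega)
        omega
      obtain ⟨p, q, r, e1, e2, -⟩ := hbd 0
      have key : (4 * N : ℝ) = (p + q) * (A + B) + (q - p) * √D + 2 * r * (A - B) := by
        apply mul_left_cancel₀ ht.ne'
        linear_combination 2 * e1 - 2 * eX + ((p : ℝ) + q) * es + ((q : ℝ) - p) * eD + 2 * r * ec
      have hqp : (q : ℤ) - p = 0 := irr_nat Dle f1 (x := q - p) (y := 4 * N - (p + q) * (A + B) - 2 * r * (A - B)) (by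
        push_cast; linear_combination - key)
      have hqp : q = p := by omega
      subst hqp
      have key2 : (2 * N : ℝ) = q * (A + B) + r * (A - B) := by linear_combination (1/2 : ℝ) * key
      have key3 : q * (A + B) + r * (A - B) = 2 * N := by
        have : ((A - B : ℕ) : ℝ) = A - B := Nat.cast_sub BA.le
        rw [← this] at key2
        exact_mod_cast key2.symm
      have hq : q < 80 := by nlinarith
      have hr' : r < 80 := by
        have : r * 1 ≤ r * (A - B) := Nat.mul_le_mul_left _ (by omega)
        have := Nat.zero_le (q * (A + B))
        omega
      obtain ⟨g1, g2⟩ := f2 q hq r hr' key3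
      obtain ⟨i, hi⟩ := e2 g2
      exact hr (by omega) i (by simpa using hi)
  · simp only [OfNat.ofNat_ne_one, if_false] at eK eL hcos
    have hP : 0 < c + (a - b) := by nlinarith
    have hQ : 0 < c - (a - b) := by linarith
    obtain ⟨A, B, t, hA, hB, ht, hAB, A3, B3, AN, BN, eP, eQ, eX, eab⟩ := prod_aux (A := K) (B := L) hP hQ
      ha hb hX eK eL (by nlinarith) harea hK hL
    have ec : c = t * (A + B) := by linear_combination (1/2 : ℝ) * (eP + eQ)
    have es : b - a = t * (A - B) := by linear_combination (1/2 : ℝ) * (eQ - eP)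
    have BA : B < A := by
      have : (0 : ℝ) < t * (A - B) := by rw [← es]; linarith
      have := pos_of_mul_pos_right this ht.le
      have : (B : ℝ) < A := by linarith
      exact_mod_cast this
    have N3 : A * B / 3 = N := by omega
    have fc := fin_check2 A (by omega) B BA (by rw [N3]; refine ⟨B3, by omega, by omega, by omega, AN⟩)
    rw [N3] at fc
    obtain ⟨D, hDe⟩ : ∃ D : ℕ, (A - B) * (A - B) + 16 * N = D := ⟨_, rfl⟩
    have hsub : ((A - B : ℕ) : ℝ) = A - B := Nat.cast_sub BA.le
    have hDr : ((A : ℝ) - B) * (A - B) + 16 * N = D := by rw [← hsub]; exact_mod_cast hDe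
    have eD : a + b = t * √D := by
      have h5 : (a + b) ^ 2 = t ^ 2 * D := by
        linear_combination ((b - a) + t * (A - B)) * es + 4 * eab + t ^ 2 * hDr
      rw [← abs_of_pos (add_pos ha hb), ← Real.sqrt_sq_eq_abs, h5, Real.sqrt_mul (by positivity), Real.sqrt_sq ht.le]
    rcases fc with ⟨rfl, rfl⟩ | ⟨f1, f2⟩
    · have hN' : N = 15 := by omega
      subst hN'
      have hD2 : D = 16 ^ 2 := by omega
      rw [hD2, sqn] at eD
      push_cast at eD es ec eX
      refine ⟨2 * t, by positivity, Or.inl ⟨rfl, ?_, ?_, ?_, ?_⟩⟩ <;> linarith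
    · rw [hDe] at f1
      have Dle : D ≤ 6320 := by
        have : (A - B) * (A - B) ≤ 39 * 39 := Nat.mul_le_mul (by omega) (by omega)
        omega
      have pq : ∀ k0, ∃ p q r : ℕ, p = 0 ∧ q = 0 ∧ r < 80 ∧ r * (A + B) = 2 * N ∧ 
         (p = 0 → q = 0 → ∀ i m, m ≠ 0 →
        ¬ (lam (Bt X) k0 (V i m) = 0 ∧ lam (Bt X) k0 (V i (m + 1)) = 0)) := by
        intro k0
        obtain ⟨p, q, r, e1, -, e3⟩ := hbd k0
        have key : (4 * N : ℝ) = (p + q) * √D + (q - p) * (A - B) + 2 * r * (A + B) := by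
          apply mul_left_cancel₀ ht.ne'
          linear_combination 2 * e1 - 2 * eX + ((p : ℝ) + q) * eD + ((q : ℝ) - p) * es + 2 * r * ec
        have hqp : (p : ℤ) + q = 0 := irr_nat Dle f1 (x := p + q) (y := 4 * N - (q - p) * (A - B) - 2 * r * (A + B)) (by
          push_cast; linear_combination - key)
        have hp : p = 0 := by omega
        have hq : q = 0 := by omega
        refine ⟨p, q, r, hp, hq, ?_, ?_, e3⟩
        all_goals
          subst hp hq
          have key2 : (r : ℝ) * (A + B) = 2 * N := by
            push_cast at key; linear_combination (-1/2 : ℝ) * key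
          have key3 : r * (A + B) = 2 * N := by exact_mod_cast key2
        · nlinarith
        · exact key3
      have bc : Hbc X V := by
        intro k0
        obtain ⟨p, q, r, hp, hq, -, -, h⟩ := pq k0
        exact h hp hq
      obtain ⟨p, q, r, hp, hq, hr1, hr2, h⟩ := pq 0
      rcases f2 r hr1 hr2 with ⟨rfl, rfl⟩ | ⟨rfl, rfl⟩
      · have hN' : N = 16 := by omega
        subst hN'
        have hD2 : D = 8 ^ 2 * 5 := by omega
        rw [hD2, sqn5] at eD
        push_cast at eD es ec eX
        refine ⟨4 * t, by positivity, Or.inr (Or.inr ⟨rfl, ?_, ?_, ?_, Or.inl ?_, bc⟩)⟩ <;> linarith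
      · have hN' : N = 36 := by omega
        subst hN'
        have hD2 : D = 12 ^ 2 * 5 := by omega
        rw [hD2, sqn5] at eD
        push_cast at eD es ec eX
        refine ⟨6 * t, by positivity, Or.inr (Or.inr ⟨rfl, ?_, ?_, ?_, Or.inr ?_, bc⟩)⟩ <;> linarith

end Setup



theorem lam_aff (V : Fin 3 → ℂ) (k : Fin 3) (v r : ℂ) (x : ℝ) :
    lam V k (v + x * r) = lam V k v + x * crs (V (k + 1) - V k) r := by
  simp [lam, crs]; ring

theorem crs_par {e r n : ℂ} (hrn : 0 < crs r n) (h1 : crs e r = 0) : e = ((crs e n / crs r n : ℝ) : ℂ) * r := by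
  unfold crs at *
  apply Complex.ext
  · rw [Complex.re_ofReal_mul]; rw [div_mul_eq_mul_div, eq_div_iff hrn.ne']; linear_combination -n.re * h1
  · rw [Complex.im_ofReal_mul]; rw [div_mul_eq_mul_div, eq_div_iff hrn.ne']; linear_combination -n.im * h1

theorem TileSys.node {N : ℕ} {B : Fin 3 → ℂ} {V : Fin N → Fin 3 → ℂ} (S : TileSys N B V) {v r n : ℂ}
    (hrn : 0 < crs r n) (hB : LexIn B v r n)
    (h2 : (∃ j, LexIn (V j) v r (-n) ∧ ¬ LexIn (V j) v r n) ∨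
      ∃ k, lam B k v = 0 ∧ crs (B (k + 1) - B k) r = 0)
    (h3 : (∃ j, CloIn (V j) v ∧ 0 < crs r (V j 0 + V j 1 + V j 2 - 3 * v) ∧ ¬ LexIn (V j) v r n) ∨
      ∃ k, lam B k v = 0 ∧ crs (B (k + 1) - B k) r ≠ 0) :
    ∃ i k, LexIn (V i) v r n ∧ V i k = v ∧ ∃ t : ℝ, 0 < t ∧ V i (k + 1) - V i k = t * r := by
  obtain ⟨i, hi⟩ := S.lex_ex hrn.ne' hB
  have hk : ∃ k, lam (V i) k v = 0 ∧ crs (V i (k + 1) - V i k) r = 0 := by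
    by_contra hcon
    push Not at hcon
    have hm : LexIn (V i) v r (-n) := by
      intro k
      rcases hi k with h | ⟨h, h' | ⟨h', _⟩⟩
      · exact Or.inl h
      · exact Or.inr ⟨h, Or.inl h'⟩
      · exact absurd h' (hcon k h)
    rcases h2 with ⟨j, hj1, hj2⟩ | ⟨k, hk1, hk2⟩
    · rw [S.lex_uniq hj1 hm] at hj2
      exact hj2 hi
    · have h5 := S.lex_up (by rw [crs_neg_right]; simpa using hrn.ne') hm k
      have h6 := hB k
      rw [crs_neg_right] at h5
      simp only [LPos, hk1, hk2, lt_irrefl, true_and, false_or] at h5 h6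
      linarith
  obtain ⟨k, hk1, hk2⟩ := hk
  have hk3 : 0 < crs (V i (k + 1) - V i k) n := by
    have := hi k
    simpa [LPos, hk1, hk2] using this
  have het := crs_par hrn hk2
  have ht : 0 < crs (V i (k + 1) - V i k) n / crs r n := div_pos hk3 hrn
  set t := crs (V i (k + 1) - V i k) n / crs r n with htdef
  clear_value t
  have hA := S.posV i
  rw [← lam_cyc _ k] at hA
  have hv : ∃ s : ℝ, v = V i k + s * (V i (k + 1) - V i k) := by
    have h7 : crs (v - V i k) r = 0 := by
      have : t * crs (v - V i k) r = 0 := by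
        have h8 := hk1
        rw [lam, het, crs_smul_left] at h8
        unfold crs at h8 ⊢
        linear_combination - h8
      simpa [ht.ne'] using this
    have h8 := crs_par hrn h7
    refine ⟨crs (v - V i k) n / crs r n / t, ?_⟩
    rw [het]
    rw [sub_eq_iff_eq_add] at h8
    have : (t : ℂ) ≠ 0 := by exact_mod_cast ht.ne'
    conv_lhs => rw [h8]
    push_cast
    field_simp
    ring
  obtain ⟨s, hs⟩ := hv
  set A := lam (V i) k (V i (k + 2)) with hAdef
  have e1 : lam (V i) (k + 1) v = (1 - s) * A := by
    rw [hs, hAdef]; simp only [lam, fin3a]; simp [crs]; ring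
  have e2 : lam (V i) (k + 2) v = s * A := by
    rw [hs, hAdef]; simp only [lam, fin3b]; simp [crs]; ring
  have e3 : t * crs (V i (k + 1 + 1) - V i (k + 1)) r = - A := by
    rw [← crs_smul_right, ← het, hAdef]; simp only [lam, fin3a]; simp [crs]; ring
  have hs1 : s < 1 := by
    by_contra hh
    push Not at hh
    have h9 := hi (k + 1)
    rw [e1] at h9
    rcases h9 with h | ⟨h, h' | ⟨h', _⟩⟩ <;> nlinarith
  have hs0 : 0 ≤ s := by
    by_contra hh
    push Not at hh
    have h9 := hi (k + 2)
    rw [e2] at h9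
    rcases h9 with h | ⟨h, _⟩ <;> nlinarith
  rcases hs0.eq_or_lt with hs0 | hs0
  · refine ⟨i, k, hi, ?_, t, ht, het⟩
    rw [hs, ← hs0]; simp
  exfalso
  rcases h3 with ⟨j, hj1, hj2, hj3⟩ | ⟨k', hk'1, hk'2⟩
  · set w := V j 0 + V j 1 + V j 2 - 3 * v with hw
    have hsj : ∀ e : ℝ, 0 < e → e ≤ 1/3 → StrIn (V j) (v + e * w) := by
      intro e he he1 k'
      have h10 : lam (V j) k' (v + e * w) = (1 - 3 * e) * lam (V j) k' v + e * lam (V j) 0 (V j 2) := by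
        rw [← lam_cyc _ k', hw]
        fin_cases k' <;> simp [lam, crs] <;> ring
      rw [h10]
      have := mul_pos he (S.posV j)
      have := mul_nonneg (by linarith : 0 ≤ 1 - 3 * e) (hj1 k')
      linarith
    have h1 : 0 < (1 - s) * A := mul_pos (by linarith) hA
    have h2 : 0 < s * A := mul_pos hs0 hA
    have ev : ∀ᶠ e : ℝ in nhdsWithin (0 : ℝ) (Set.Ioi 0), StrIn (V i) (v + e * w) := by
      unfold StrIn
      simp only [lam_aff]
      rw [Filter.eventually_all]
      have hh := (fin3c k (fun x => ∀ᶠ e : ℝ in nhdsWithin (0 : ℝ) (Set.Ioi 0), 0 < lam (V i) x v + e * crs (V i (x + 1) - V i x) w)).2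
      apply hh
      have hev : ∀ x y : ℝ, LPos x y 0 → ∀ᶠ e : ℝ in nhdsWithin (0 : ℝ) (Set.Ioi 0), 0 < x + e * y := by
        intro x y h
        filter_upwards [lpos_ev h] with e he
        simpa using he
      refine ⟨hev _ _ (Or.inr ⟨hk1, Or.inl ?_⟩), hev _ _ (Or.inl (e1 ▸ h1)), hev _ _ (Or.inl (e2 ▸ h2))⟩
      rw [het, crs_smul_left]
      exact mul_pos ht hj2
    have ev2 : ∀ᶠ e : ℝ in nhdsWithin (0 : ℝ) (Set.Ioi 0), StrIn (V j) (v + e * w) := by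
      filter_upwards [eventually_mem_nhdsWithin, eventually_nhdsWithin_of_eventually_nhds (eventually_le_nhds (show (0:ℝ) < 1/3 by norm_num))] with e h1 h2
      exact hsj e h1 h2
    obtain ⟨e, h5, h6⟩ := (ev.and ev2).exists
    rw [S.dis i j _ h5 h6] at hi
    exact hj3 hi
  · have q1 := (S.cov _).2 ⟨i, clo_vert (S.posV i) k⟩ k'
    have q2 := (S.cov _).2 ⟨i, clo_vert (S.posV i) (k + 1)⟩ k'
    have f1 : V i k = v + ((-(s * t) : ℝ) : ℂ) * r := by
      conv_rhs => rw [hs, het]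
      push_cast; ring
    have f2 : V i (k + 1) = v + (((1 - s) * t : ℝ) : ℂ) * r := by
      have : V i (k + 1) = V i k + t * r := by rw [← het]; ring
      rw [this, f1]; push_cast; ring
    rw [f1, lam_aff, hk'1] at q1
    rw [f2, lam_aff, hk'1] at q2
    have p1 : 0 < s * t := mul_pos hs0 ht
    have p2 : 0 < (1 - s) * t := mul_pos (by linarith) ht
    rcases lt_or_gt_of_ne hk'2 with h | h <;> nlinarith

theorem unit_eq {l t ρ : ℝ} {d r : ℂ} (hl : 0 < l) (ht : 0 < t) (hd : ‖d‖ = 1) (hr : ‖r‖ = ρ)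
    (h : (l : ℂ) * d = t * r) : r = ρ * d := by
  have h1 : l = t * ρ := by
    have := congrArg norm h
    simpa [hd, hr, abs_of_pos hl, abs_of_pos ht] using this
  have : (t : ℂ) ≠ 0 := by exact_mod_cast ht.ne'
  apply mul_left_cancel₀ this
  rw [← h, h1]; push_cast; ring

theorem Setup.opts {N : ℕ} {a b c X : ℝ} {ea eb : ℂ} {g : ℕ} {V : Fin N → Fin 3 → ℂ}
    (H : Setup N a b c X ea eb g V) {a' b' c' ρ : ℝ} (ha : a = a' * ρ) (hb : b = b' * ρ)
    (hc : c = c' * ρ) {r : ℂ} (hr : ‖r‖ = ρ) {i : Fin N} {k : Fin 3} {t : ℝ} (ht : 0 < t)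
    (h : V i (k + 1) - V i k = t * r) :
    (k = 0 ∧ V i (k + 1) = V i k + c' * r ∧ V i (k + 2) = V i k + b' * (ea * r)) ∨
    (k = 0 ∧ V i (k + 1) = V i k + c' * r ∧ V i (k + 2) = V i k + a' * (eb * r)) ∨
    (k = 1 ∧ V i (k + 1) = V i k + a' * r ∧ V i (k + 2) = V i k + c' * (eb * r)) ∨
    (k = 1 ∧ V i (k + 1) = V i k + b' * r ∧ V i (k + 2) = V i k + c' * (ea * r)) ∨
    (k = 2 ∧ V i (k + 1) = V i k + b' * r ∧ V i (k + 2) = V i k + a' * (zt ^ g * r)) ∨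
    (k = 2 ∧ V i (k + 1) = V i k + a' * r ∧ V i (k + 2) = V i k + b' * (zt ^ g * r)) := by
  obtain ⟨u, hu, h1, h2⟩ := H.tile i
  have na := H.na
  have nb := H.nb
  have nea := norm_ne H.na
  have neb := norm_ne H.nb
  have tri := H.tri
  have tri' := H.tri'
  have ang := H.ang
  have ang1 : ea⁻¹ = - (eb * zt ^ g) := by
    rw [inv_eq_iff_eq_inv, eq_comm, inv_eq_of_mul_eq_one_right]; linear_combination - ang
  have ang2 : eb⁻¹ = - (ea * zt ^ g) := H.eb_eq
  have ac : (a : ℂ) = a' * ρ := by rw [ha]; push_cast; ring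
  have bc : (b : ℂ) = b' * ρ := by rw [hb]; push_cast; ring
  have cc : (c : ℂ) = c' * ρ := by rw [hc]; push_cast; ring
  have Ha := H.ha; have Hb := H.hb; have Hc := H.hc
  rcases h2 with h2 | h2
  · have : k = 0 ∨ k = 1 ∨ k = 2 := by fin_cases k <;> simp
    rcases this with rfl | rfl | rfl
    · left
      have h := h
      simp only [zero_add] at h ⊢
      have e := unit_eq Hc ht hu hr (by rw [← h, h1]; ring)
      refine ⟨trivial, ?_, ?_⟩
      · rw [h1, e, cc]; ring
      · rw [h2, e, bc]; ring
    · right; right; left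
      simp only [show (1 : Fin 3) + 1 = 2 from rfl, show (1 : Fin 3) + 2 = 0 from rfl] at h ⊢
      have e := unit_eq (d := - u * eb⁻¹) Ha ht (by simp [hu, nb]) hr (by rw [← h, h1, h2, tri]; ring)
      refine ⟨trivial, ?_, ?_⟩
      · rw [h1, h2, e, tri, ac, bc]; ring
      · rw [h1, e, cc]; field_simp; ring
    · right; right; right; right; left
      simp only [show (2 : Fin 3) + 1 = 0 from rfl, show (2 : Fin 3) + 2 = 1 from rfl] at h ⊢
      have e := unit_eq (d := - u * ea) Hb ht (by simp [hu, na]) hr (by rw [← h, h2]; ring)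
      refine ⟨trivial, ?_, ?_⟩
      · rw [h2, e, bc]; ring
      · rw [h1, h2, e, tri, ang2, ac, bc]; ring
  · have : k = 0 ∨ k = 1 ∨ k = 2 := by fin_cases k <;> simp
    rcases this with rfl | rfl | rfl
    · right; left
      have h := h
      simp only [zero_add] at h ⊢
      have e := unit_eq Hc ht hu hr (by rw [← h, h1]; ring)
      refine ⟨trivial, ?_, ?_⟩
      · rw [h1, e, cc]; ring
      · rw [h2, e, ac]; ring
    · right; right; right; left
      simp only [show (1 : Fin 3) + 1 = 2 from rfl, show (1 : Fin 3) + 2 = 0 from rfl] at h ⊢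
      have e := unit_eq (d := - u * ea⁻¹) Hb ht (by simp [hu, na]) hr (by rw [← h, h1, h2, tri']; ring)
      refine ⟨trivial, ?_, ?_⟩
      · rw [h1, h2, e, tri', ac, bc]; ring
      · rw [h1, e, cc]; field_simp; ring
    · right; right; right; right; right
      simp only [show (2 : Fin 3) + 1 = 0 from rfl, show (2 : Fin 3) + 2 = 1 from rfl] at h ⊢
      have e := unit_eq (d := - u * eb) Ha ht (by simp [hu, nb]) hr (by rw [← h, h2]; ring)
      refine ⟨trivial, ?_, ?_⟩
      · rw [h2, e, ac]; ring
      · rw [h1, h2, e, tri', ang1, ac, bc]; ring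



structure Z5 where
  p : Int
  q : Int

structure P5 where
  x : Z5
  y : Z5

structure Tl where
  p0 : P5
  p1 : P5
  p2 : P5

structure Par where
  tab : List P5
  a : Z5
  b : Z5
  c : Z5
  X : Z5
  g : ℕ
  bc : Bool

namespace Z5
def add (a b : Z5) : Z5 := ⟨Int.add a.p b.p, Int.add a.q b.q⟩
def neg (a : Z5) : Z5 := ⟨Int.neg a.p, Int.neg a.q⟩
def sub (a b : Z5) : Z5 := a.add b.neg
def mul (a b : Z5) : Z5 := ⟨Int.add (Int.mul a.p b.p) (Int.mul 5 (Int.mul a.q b.q)),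
  Int.add (Int.mul a.p b.q) (Int.mul a.q b.p)⟩
def posI : Int → Int → Bool
  | .ofNat p, .ofNat q => Nat.blt 0 (Nat.add p q)
  | .ofNat p, .negSucc q => Nat.blt (5 * ((q + 1) * (q + 1))) (p * p)
  | .negSucc p, .ofNat q => Nat.blt ((p + 1) * (p + 1)) (5 * (q * q))
  | .negSucc _, .negSucc _ => false
def pos (a : Z5) : Bool := posI a.p a.q
def zerI : Int → Bool
  | .ofNat p => Nat.beq p 0
  | .negSucc _ => false
def zer (a : Z5) : Bool := zerI a.p && zerI a.q
end Z5

namespace P5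
def add (a b : P5) : P5 := ⟨a.x.add b.x, a.y.add b.y⟩
def neg (a : P5) : P5 := ⟨a.x.neg, a.y.neg⟩
def sub (a b : P5) : P5 := ⟨a.x.sub b.x, a.y.sub b.y⟩
def smul (s : Z5) (a : P5) : P5 := ⟨s.mul a.x, s.mul a.y⟩
def rot (a : P5) : P5 := ⟨a.y.neg, a.x.add a.y⟩
def rots (m : ℕ) (a : P5) : P5 := Nat.rec a (fun _ b => b.rot) m
def det (a b : P5) : Z5 := (a.x.mul b.y).sub (a.y.mul b.x)
def zero : P5 := ⟨⟨0, 0⟩, ⟨0, 0⟩⟩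
end P5

section force
variable {R : Type}
def frcN (n : ℕ) (k : ℕ → R) : R := Nat.rec (k 0) (fun m _ => k (Nat.succ m)) n
def frcI (z : Int) (k : Int → R) : R :=
  match z with
  | .ofNat n => frcN n fun n => k (.ofNat n)
  | .negSucc n => frcN n fun n => k (.negSucc n)
def frcZ (z : Z5) (k : Z5 → R) : R := frcI z.p fun p => frcI z.q fun q => k ⟨p, q⟩
def frcP (z : P5) (k : P5 → R) : R := frcZ z.x fun x => frcZ z.y fun y => k ⟨x, y⟩
def rd (n : ℕ) (k : ℕ → ℕ → R) : R := frcN (n % 128) fun d => frcN (n / 128) fun n => k d n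
def nth (dflt : R) (L : List Tl) (i : ℕ) (k : Tl → R) : R :=
  List.rec (motive := fun _ => ℕ → R) (fun _ => dflt)
    (fun t _ ih i => Nat.rec (motive := fun _ => R) (k t) (fun m _ => ih m) i) L i
end force

namespace Tl
def get (T : Tl) (i : ℕ) : P5 := Nat.rec T.p0 (fun i _ => Nat.rec T.p1 (fun _ _ => T.p2) i) i
def ed (T : Tl) (k : ℕ) (r : P5) : Z5 := ((T.get ((k + 1) % 3)).sub (T.get k)).det r
def lm (T : Tl) (k : ℕ) (v : P5) : Z5 := T.ed k (v.sub (T.get k))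
def all (f : ℕ → Bool) : Bool := f 0 && (f 1 && f 2)
def any (f : ℕ → Bool) : Bool := f 0 || (f 1 || f 2)
def lex (T : Tl) (v r n : P5) : Bool := all fun k =>
  (T.lm k v).pos || ((T.lm k v).zer && ((T.ed k r).pos || ((T.ed k r).zer && (T.ed k n).pos)))
def nlex (T : Tl) (v r n : P5) : Bool := any fun k =>
  (T.lm k v).neg.pos || ((T.lm k v).zer && ((T.ed k r).neg.pos || ((T.ed k r).zer && (T.ed k n).neg.pos)))
def clo (T : Tl) (v : P5) : Bool := all fun k => (T.lm k v).pos || (T.lm k v).zer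
def out (T : Tl) (v : P5) : Bool := any fun k => (T.lm k v).neg.pos
def str (T : Tl) (s : Z5) (w : P5) : Bool := all fun k => (T.ed k (w.sub (P5.smul s (T.get k)))).pos
def bcv (T : Tl) (p q r : P5) : Bool := any fun k =>
  (T.lm k q).zer && ((T.lm k p).zer || (T.lm k r).zer)
def dl (T : Tl) (v r : P5) : Z5 := r.det (((T.p0.add T.p1).add T.p2).sub (P5.smul ⟨3, 0⟩ v))
end Tl

namespace Par
def B (P : Par) : Tl := ⟨P5.zero, ⟨P.X, ⟨0, 0⟩⟩, ⟨⟨0, 0⟩, P.X⟩⟩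
def dir (P : Par) (J m : ℕ) : P5 := P5.rots m (P.tab.getD J P5.zero)
def natZ (n : ℕ) : Z5 := ⟨.ofNat n, 0⟩

def ovl (t : Tl) (v v1 w r n : P5) (y z : ℕ) : Bool :=
  Nat.blt 0 y && (Nat.blt 0 z && (Nat.blt (y + z) 128 && (t.nlex v r n &&
    t.str ⟨128, 0⟩ ((P5.smul (natZ (128 - (y + z))) v).add ((P5.smul (natZ y) v1).add (P5.smul (natZ z) w))))))

def opt1 (P : Par) (sub : List Tl → ℕ → Option ℕ) (L : List Tl) (v r n v1 w : P5) (kk d st : ℕ) : Option ℕ :=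
  Nat.rec (cond (P.B.out v1 || P.B.out w) (some st) none) (fun d _ =>
    Nat.rec (cond (P.bc && Nat.rec (P.B.bcv v1 w v) (fun kk _ => Nat.rec (P.B.bcv v v1 w) (fun _ _ => P.B.bcv w v v1) kk) kk)
        (some st) none) (fun d _ =>
      Nat.rec (sub (⟨v, v1, w⟩ :: L) st) (fun d _ =>
        rd st fun y st => rd st fun z st => nth none L d fun t => cond (ovl t v v1 w r n y z) (some st) none) d) d) d

def opt (P : Par) (sub : List Tl → ℕ → Option ℕ) (L : List Tl) (v r n : P5) (l1 l2 : Z5) (rt : P5) (kk st : ℕ) : Option ℕ :=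
  rd st fun d st => frcP (v.add (P5.smul l1 r)) fun v1 => frcP (v.add (P5.smul l2 rt)) fun w =>
    opt1 P sub L v r n v1 w kk d st

def blk1 (P : Par) (L : List Tl) (v r n : P5) (d : ℕ) : Bool :=
  cond (Nat.blt d 3) ((P.B.lm d v).zer && (P.B.ed d r).zer)
    (nth false L (d / 3 - 1) fun t => t.lex v r n.neg && t.nlex v r n)
def blk2 (P : Par) (L : List Tl) (v r n : P5) (d : ℕ) : Bool :=
  cond (Nat.blt d 3) ((P.B.lm d v).zer && ((P.B.ed d r).pos || (P.B.ed d r).neg.pos))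
    (nth false L (d / 3 - 1) fun t => t.clo v && ((t.dl v r).pos && t.nlex v r n))

def node1 (P : Par) (sub : List Tl → ℕ → Option ℕ) (L : List Tl) (v r n rA rB rG : P5) (st : ℕ) : Option ℕ :=
  (P.opt sub L v r n P.c P.b rA 0 st).bind fun st =>
  (P.opt sub L v r n P.c P.a rB 0 st).bind fun st =>
  (P.opt sub L v r n P.a P.c rB 1 st).bind fun st =>
  (P.opt sub L v r n P.b P.c rA 1 st).bind fun st =>
  (P.opt sub L v r n P.b P.a rG 2 st).bind fun st =>
  P.opt sub L v r n P.a P.b rG 2 st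

def node (P : Par) (sub : List Tl → ℕ → Option ℕ) (L : List Tl) (st : ℕ) : Option ℕ :=
  rd st fun dv st => rd st fun dr st => rd st fun d1 st => rd st fun d2 st =>
  nth none (P.B :: L) (dv / 3) fun tv => frcP (tv.get (dv % 3)) fun v =>
  frcN (dr / 6) fun J => frcN (dr % 6) fun m =>
  frcP (P.dir (J + 1) m) fun r => frcP (r.rot) fun n =>
  frcP (P.dir (J + 2) m) fun rA => frcP (P.dir J (m + (3 - P.g))) fun rB => frcP (P.dir (J + 1) (m + P.g)) fun rG =>
  cond (Nat.ble J 6 && (P.B.lex v r n && (P.blk1 L v r n d1 && P.blk2 L v r n d2)))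
    (P.node1 sub L v r n rA rB rG st) none

def chk (P : Par) (f : ℕ) : List Tl → ℕ → Option ℕ :=
  Nat.rec (fun _ _ => none) (fun _ ih => P.node ih) f
def ok (P : Par) (st : ℕ) : Bool := (P.chk 40 [] st).isSome
end Par

def tabI : List P5 := [⟨⟨1504, 0⟩, ⟨-2769, 0⟩⟩, ⟨⟨2261, 0⟩, ⟨-2520, 0⟩⟩, ⟨⟨2695, 0⟩, ⟨-1911, 0⟩⟩, ⟨⟨2744, 0⟩, ⟨-1029, 0⟩⟩,
  ⟨⟨2401, 0⟩, ⟨0, 0⟩⟩, ⟨⟨1715, 0⟩, ⟨1029, 0⟩⟩, ⟨⟨784, 0⟩, ⟨1911, 0⟩⟩, ⟨⟨-259, 0⟩, ⟨2520, 0⟩⟩, ⟨⟨-1265, 0⟩, ⟨2769, 0⟩⟩]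
def tabG : List P5 := [⟨⟨0, 14⟩, ⟨-17, -7⟩⟩, ⟨⟨22, 6⟩, ⟨0, -12⟩⟩, ⟨⟨28, 4⟩, ⟨-28, 4⟩⟩, ⟨⟨0, 16⟩, ⟨8, -8⟩⟩, ⟨⟨32, 0⟩, ⟨0, 0⟩⟩,
  ⟨⟨8, 8⟩, ⟨-8, 8⟩⟩, ⟨⟨0, 8⟩, ⟨28, -4⟩⟩, ⟨⟨22, -6⟩, ⟨0, 12⟩⟩, ⟨⟨-17, 7⟩, ⟨17, 7⟩⟩]
def par1 : Par := ⟨tabI, ⟨3, 0⟩, ⟨5, 0⟩, ⟨7, 0⟩, ⟨15 * 2401, 0⟩, 2, false⟩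
def par2 : Par := ⟨tabI, ⟨3, 0⟩, ⟨8, 0⟩, ⟨7, 0⟩, ⟨24 * 2401, 0⟩, 1, false⟩
def par3 (x : ℕ) : Par := ⟨tabG, ⟨-1, 1⟩, ⟨1, 1⟩, ⟨4, 0⟩, ⟨x * 32, 0⟩, 2, true⟩



def Z5.ev (z : Z5) : ℝ := z.p + z.q * √5
theorem s5 : √5 * √5 = 5 := Real.mul_self_sqrt (by norm_num)
theorem s5p : 0 < √5 := by positivity

namespace Z5
theorem ev_add (a b : Z5) : (a.add b).ev = a.ev + b.ev := by
  have h : ∀ x y : ℤ, Int.add x y = x + y := fun _ _ => rfl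
  simp only [ev, add, h]; push_cast; ring
theorem ev_neg (a : Z5) : a.neg.ev = - a.ev := by
  have h : ∀ x : ℤ, Int.neg x = - x := fun _ => rfl
  simp only [ev, neg, h]; push_cast; ring
theorem ev_sub (a b : Z5) : (a.sub b).ev = a.ev - b.ev := by
  rw [sub, ev_add, ev_neg]; ring
theorem ev_mul (a b : Z5) : (a.mul b).ev = a.ev * b.ev := by
  have h : ∀ x y : ℤ, Int.add x y = x + y := fun _ _ => rfl
  have h' : ∀ x y : ℤ, Int.mul x y = x * y := fun _ _ => rfl
  simp only [ev, mul, h, h']; push_cast; linear_combination (- (a.q : ℝ) * b.q) * s5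
theorem pos_ev {a : Z5} (h : a.pos = true) : 0 < a.ev := by
  obtain ⟨p, q⟩ := a
  have h5 := s5
  have h5p := s5p
  rcases p with p | p <;> rcases q with q | q <;> simp only [pos, posI, Nat.blt_eq] at h <;> simp only [ev, Int.ofNat_eq_natCast, Int.cast_natCast, Int.cast_negSucc]
  · have : 0 < p ∨ 0 < q := by
      have h' : 0 < p + q := h
      omega
    have h1 : (0 : ℝ) ≤ p := by positivity
    have h2 : (0 : ℝ) ≤ q := by positivity
    rcases this with h | h
    · have : (0 : ℝ) < p := by exact_mod_cast h
      positivity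
    · have : (0 : ℝ) < q := by exact_mod_cast h
      positivity
  · have h2 : (5 : ℝ) * ((q + 1) * (q + 1)) < p * p := by exact_mod_cast h
    have h1 : (0 : ℝ) ≤ p := by positivity
    have h3 : (0 : ℝ) ≤ (q + 1) * √5 := by positivity
    have : ((q : ℝ) + 1) * √5 < p := by
      apply lt_of_mul_self_lt_mul_self₀ h1
      calc ((q : ℝ) + 1) * √5 * ((q + 1) * √5) = 5 * ((q + 1) * (q + 1)) := by linear_combination ((q : ℝ) + 1) ^ 2 * h5
        _ < _ := h2
    push_cast
    linarith
  · have h2 : ((p : ℝ) + 1) * (p + 1) < 5 * (q * q) := by exact_mod_cast h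
    have : ((p : ℝ) + 1) < q * √5 := by
      apply lt_of_mul_self_lt_mul_self₀ (by positivity)
      calc ((p : ℝ) + 1) * (p + 1) < 5 * (q * q) := h2
        _ = _ := by linear_combination - (q : ℝ) ^ 2 * h5
    push_cast
    linarith
  · simp at h
theorem zer_ev {a : Z5} (h : a.zer = true) : a.ev = 0 := by
  obtain ⟨p, q⟩ := a
  rcases p with p | p <;> rcases q with q | q <;> simp [zer, zerI] at h
  simp [ev, h.1, h.2]
end Z5

namespace P5
def emb (κ : ℝ) (P : P5) : ℂ := κ * (P.x.ev + P.y.ev * zt)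
variable {κ : ℝ}
theorem emb_add (a b : P5) : emb κ (a.add b) = emb κ a + emb κ b := by
  simp only [emb, add, Z5.ev_add]; push_cast; ring
theorem emb_neg (a : P5) : emb κ a.neg = - emb κ a := by
  simp only [emb, neg, Z5.ev_neg]; push_cast; ring
theorem emb_sub (a b : P5) : emb κ (a.sub b) = emb κ a - emb κ b := by
  simp only [emb, sub, Z5.ev_sub]; push_cast; ring
theorem emb_smul (s : Z5) (a : P5) : emb κ (smul s a) = s.ev * emb κ a := by
  simp only [emb, smul, Z5.ev_mul]; push_cast; ring
theorem emb_rot (a : P5) : emb κ a.rot = zt * emb κ a := by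
  simp only [emb, rot, Z5.ev_neg, Z5.ev_add]; push_cast
  linear_combination (- (κ : ℂ) * a.y.ev) * zt_sq
theorem emb_rots (m : ℕ) (a : P5) : emb κ (rots m a) = zt ^ m * emb κ a := by
  induction m with
  | zero => simp [rots]
  | succ m ih =>
    have : rots (m + 1) a = (rots m a).rot := rfl
    rw [this, emb_rot, ih]; ring
theorem emb_zero : emb κ zero = 0 := by simp [emb, zero, Z5.ev]
theorem crs_emb (a b : P5) : crs (emb κ a) (emb κ b) = κ ^ 2 * (√3 / 2) * (a.det b).ev := by
  simp only [det, Z5.ev_sub, Z5.ev_mul]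
  simp [crs, emb, zt]; ring
end P5

open P5

theorem frcN_eq {R : Type} (n : ℕ) (k : ℕ → R) : frcN n k = k n := by cases n <;> rfl
theorem frcI_eq {R : Type} (n : ℤ) (k : ℤ → R) : frcI n k = k n := by
  cases n <;> simp [frcI, frcN_eq]
theorem frcZ_eq {R : Type} (n : Z5) (k : Z5 → R) : frcZ n k = k n := by simp [frcZ, frcI_eq]
theorem frcP_eq {R : Type} (n : P5) (k : P5 → R) : frcP n k = k n := by simp [frcP, frcZ_eq]
theorem rd_eq {R : Type} (n : ℕ) (k : ℕ → ℕ → R) : rd n k = k (n % 128) (n / 128) := by simp [rd, frcN_eq]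
theorem nth_cases {R : Type} (dflt : R) (L : List Tl) (i : ℕ) (k : Tl → R) :
    nth dflt L i k = dflt ∨ ∃ t ∈ L, nth dflt L i k = k t := by
  induction L generalizing i with
  | nil => left; rfl
  | cons t L ih =>
    cases i with
    | zero => right; exact ⟨t, by simp, rfl⟩
    | succ i =>
      rcases ih i with h | ⟨t', h, h'⟩
      · left; exact h
      · right; exact ⟨t', by simp [h], h'⟩
theorem nth_some {L : List Tl} {i : ℕ} {k : Tl → Option ℕ} {y : ℕ} (h : nth none L i k = some y) :
    ∃ t ∈ L, k t = some y := by
  rcases nth_cases none L i k with h1 | ⟨t, ht, h1⟩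
  · rw [h1] at h; cases h
  · exact ⟨t, ht, h1 ▸ h⟩
theorem nth_true {L : List Tl} {i : ℕ} {k : Tl → Bool} (h : nth false L i k = true) :
    ∃ t ∈ L, k t = true := by
  rcases nth_cases false L i k with h1 | ⟨t, ht, h1⟩
  · rw [h1] at h; cases h
  · exact ⟨t, ht, h1 ▸ h⟩
theorem cond_some {c : Bool} {x : Option ℕ} {y : ℕ} (h : cond c x none = some y) : c = true ∧ x = some y := by
  cases c
  · cases h
  · exact ⟨rfl, h⟩

def embT (κ : ℝ) (T : Tl) : Fin 3 → ℂ := fun k => emb κ (T.get k.val)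

namespace Tl
variable {κ : ℝ}
theorem all_iff {f : ℕ → Bool} : all f = true ↔ ∀ k : Fin 3, f k.val = true := by
  simp [all, Fin.forall_fin_succ]
theorem any_iff {f : ℕ → Bool} : any f = true ↔ ∃ k : Fin 3, f k.val = true := by
  simp [any, Fin.exists_fin_succ]
theorem ed_eq (T : Tl) (k : Fin 3) (r : P5) :
    crs (embT κ T (k + 1) - embT κ T k) (emb κ r) = κ ^ 2 * (√3 / 2) * (T.ed k.val r).ev := by
  rw [ed, ← crs_emb, emb_sub]; congr 1
theorem lm_eq (T : Tl) (k : Fin 3) (v : P5) :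
    lam (embT κ T) k (emb κ v) = κ ^ 2 * (√3 / 2) * (T.lm k.val v).ev := by
  rw [lm, ← ed_eq, emb_sub]; rfl
theorem cpos (hκ : 0 < κ) : 0 < κ ^ 2 * (√3 / 2) := by positivity

theorem lex_sound (hκ : 0 < κ) {T : Tl} {v r n : P5} (h : T.lex v r n = true) :
    LexIn (embT κ T) (emb κ v) (emb κ r) (emb κ n) := by
  intro k
  have := all_iff.1 h k
  rw [lm_eq, ed_eq, ed_eq]
  have hC := cpos hκ
  simp only [Bool.or_eq_true, Bool.and_eq_true] at this
  rcases this with h | ⟨h, h' | ⟨h', h''⟩⟩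
  · exact Or.inl (mul_pos hC (Z5.pos_ev h))
  · exact Or.inr ⟨by rw [Z5.zer_ev h]; simp, Or.inl (mul_pos hC (Z5.pos_ev h'))⟩
  · exact Or.inr ⟨by rw [Z5.zer_ev h]; simp, Or.inr ⟨by rw [Z5.zer_ev h']; simp, (mul_pos hC (Z5.pos_ev h''))⟩⟩

theorem neg_pos' (hκ : 0 < κ) {z : Z5} (h : z.neg.pos = true) : κ ^ 2 * (√3 / 2) * z.ev < 0 := by
  have := Z5.pos_ev h
  rw [Z5.ev_neg] at this
  exact mul_neg_of_pos_of_neg (cpos hκ) (by linarith)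

theorem nlex_sound (hκ : 0 < κ) {T : Tl} {v r n : P5} (h : T.nlex v r n = true) :
    ¬ LexIn (embT κ T) (emb κ v) (emb κ r) (emb κ n) := by
  intro hh
  obtain ⟨k, this⟩ := any_iff.1 h
  have hk := hh k
  rw [lm_eq, ed_eq, ed_eq] at hk
  simp only [Bool.or_eq_true, Bool.and_eq_true] at this
  rcases this with h | ⟨h, h' | ⟨h', h''⟩⟩
  · have := neg_pos' hκ h
    rcases hk with hk | ⟨hk, _⟩ <;> linarith
  · have := neg_pos' hκ h'
    rcases hk with hk | ⟨hk, hk' | ⟨hk', _⟩⟩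
    · rw [Z5.zer_ev h] at hk; simp at hk
    · linarith
    · linarith
  · have := neg_pos' hκ h''
    rcases hk with hk | ⟨hk, hk' | ⟨hk', _⟩⟩
    · rw [Z5.zer_ev h] at hk; simp at hk
    · rw [Z5.zer_ev h'] at hk'; simp at hk'
    · linarith

theorem clo_sound (hκ : 0 < κ) {T : Tl} {v : P5} (h : T.clo v = true) : CloIn (embT κ T) (emb κ v) := by
  intro k
  have := all_iff.1 h k
  rw [lm_eq]
  simp only [Bool.or_eq_true] at this
  rcases this with h | h
  · exact (mul_pos (cpos hκ) (Z5.pos_ev h)).le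
  · rw [Z5.zer_ev h]; simp

theorem out_sound (hκ : 0 < κ) {T : Tl} {v : P5} (h : T.out v = true) : ¬ CloIn (embT κ T) (emb κ v) := by
  intro hh
  obtain ⟨k, h⟩ := any_iff.1 h
  have := hh k
  rw [lm_eq] at this
  have := neg_pos' hκ h
  linarith

theorem str_sound (hκ : 0 < κ) {T : Tl} {w : P5} {s : Z5} (hs : 0 < s.ev) (h : T.str s w = true) :
    StrIn (embT κ T) (emb κ w / s.ev) := by
  intro k
  have := Z5.pos_ev (all_iff.1 h k)
  have h2 := mul_pos (cpos hκ) this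
  rw [← ed_eq, emb_sub, emb_smul] at h2
  have h3 : emb κ w - s.ev * emb κ (T.get k.val) = s.ev * (emb κ w / s.ev - embT κ T k) := by
    have : (s.ev : ℂ) ≠ 0 := by exact_mod_cast hs.ne'
    rw [mul_sub, mul_div_cancel₀ _ this]; rfl
  rw [h3, crs_smul_right] at h2
  exact pos_of_mul_pos_right h2 hs.le
end Tl

def isVal {N : ℕ} (κ : ℝ) (V : Fin N → Fin 3 → ℂ) (T : Tl) : Prop :=
  ∃ i k, embT κ T = fun m => V i (k + m)

theorem lam_rotT (V : Fin 3 → ℂ) (k m : Fin 3) (z : ℂ) : lam (fun m => V (k + m)) m z = lam V (k + m) z := by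
  simp [lam, add_assoc]
theorem all_rotT (k : Fin 3) (f : Fin 3 → Prop) : (∀ m, f (k + m)) ↔ ∀ m, f m :=
  ⟨fun h m => by have := h (m - k); rwa [add_sub_cancel] at this, fun h m => h _⟩
theorem clo_rotT (V : Fin 3 → ℂ) (k : Fin 3) (z : ℂ) : CloIn (fun m => V (k + m)) z ↔ CloIn V z := by
  simp only [CloIn, lam_rotT]; exact all_rotT k fun m => 0 ≤ lam V m z
theorem str_rotT (V : Fin 3 → ℂ) (k : Fin 3) (z : ℂ) : StrIn (fun m => V (k + m)) z ↔ StrIn V z := by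
  simp only [StrIn, lam_rotT]; exact all_rotT k fun m => 0 < lam V m z
theorem lex_rotT (V : Fin 3 → ℂ) (k : Fin 3) (v r n : ℂ) : LexIn (fun m => V (k + m)) v r n ↔ LexIn V v r n := by
  simp only [LexIn, lam_rotT, ← add_assoc]
  exact all_rotT k fun m => LPos (lam V m v) (crs (V (m + 1) - V m) r) (crs (V (m + 1) - V m) n)
theorem sum_rotT (V : Fin 3 → ℂ) (k : Fin 3) : V (k + 0) + V (k + 1) + V (k + 2) = V 0 + V 1 + V 2 := by
  fin_cases k <;> simp <;> ring

theorem str_comb {V : Fin 3 → ℂ} (hV : 0 < lam V 0 (V 2)) (k : Fin 3) {x y z : ℝ} (hx : 0 < x) (hy : 0 < y) (hz : 0 < z)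
    (hs : x + y + z = 1) : StrIn V (x * V k + y * V (k + 1) + z * V (k + 2)) := by
  intro m
  have hx' : x = 1 - y - z := by linarith
  have : ∃ w : ℝ, 0 < w ∧ lam V m (x * V k + y * V (k + 1) + z * V (k + 2)) = w * lam V 0 (V 2) := by
    fin_cases k <;> fin_cases m
    · exact ⟨z, hz, by rw [hx']; simp [lam, crs]; ring⟩
    · exact ⟨x, hx, by rw [hx']; simp [lam, crs]; ring⟩
    · exact ⟨y, hy, by rw [hx']; simp [lam, crs]; ring⟩
    · exact ⟨y, hy, by rw [hx']; simp [lam, crs]; ring⟩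
    · exact ⟨z, hz, by rw [hx']; simp [lam, crs]; ring⟩
    · exact ⟨x, hx, by rw [hx']; simp [lam, crs]; ring⟩
    · exact ⟨x, hx, by rw [hx']; simp [lam, crs]; ring⟩
    · exact ⟨y, hy, by rw [hx']; simp [lam, crs]; ring⟩
    · exact ⟨z, hz, by rw [hx']; simp [lam, crs]; ring⟩
  obtain ⟨w, hw, e⟩ := this
  rw [e]; exact mul_pos hw hV


open P5

structure Good {N : ℕ} (P : Par) (κ ρ a b c X : ℝ) (ea eb : ℂ) (V : Fin N → Fin 3 → ℂ) : Prop where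
  H : Setup N a b c X ea eb P.g V
  hκ : 0 < κ
  hρ : 0 < ρ
  ha : a = P.a.ev * ρ
  hb : b = P.b.ev * ρ
  hc : c = P.c.ev * ρ
  hX : X = κ * P.X.ev
  step : ∀ J < 8, emb κ (P.tab.getD (J + 1) zero) = ea * emb κ (P.tab.getD J zero)
  nrm : ∀ J < 8, ‖emb κ (P.tab.getD J zero)‖ = ρ
  hbc : P.bc = true → Setup.Hbc X V

namespace Good
variable {N : ℕ} {P : Par} {κ ρ a b c X : ℝ} {ea eb : ℂ} {V : Fin N → Fin 3 → ℂ}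

theorem hB (G : Good P κ ρ a b c X ea eb V) : embT κ P.B = Bt X := by
  funext k
  have : (⟨0, 0⟩ : Z5).ev = 0 := by simp [Z5.ev]
  fin_cases k
  · simp [embT, Tl.get, Par.B, emb_zero, Bt]
  · simp [embT, Tl.get, Par.B, Bt, emb, this, G.hX]
  · simp [embT, Tl.get, Par.B, Bt, emb, this, G.hX]; ring

theorem natZ_ev (n : ℕ) : (Par.natZ n).ev = n := by simp [Par.natZ, Z5.ev]

theorem opt_sound (G : Good P κ ρ a b c X ea eb V) {sub : List Tl → ℕ → Option ℕ}
    (hsub : ∀ L st st', (∀ t ∈ L, isVal κ V t) → sub L st = some st' → False)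
    {L : List Tl} (hL : ∀ t ∈ L, isVal κ V t) {v r n : P5} {i : Fin N} {k : Fin 3}
    (hlex : LexIn (V i) (emb κ v) (emb κ r) (emb κ n)) (hv : V i k = emb κ v)
    {l1 l2 : Z5} {rt : P5} {st st' : ℕ} (h1 : V i (k + 1) = V i k + l1.ev * emb κ r)
    (h2 : V i (k + 2) = V i k + l2.ev * emb κ rt)
    (h : P.opt sub L v r n l1 l2 rt k.val st = some st') : False := by
  have hκ := G.hκ
  have S := G.H.S
  rw [Par.opt, rd_eq, frcP_eq, frcP_eq] at h
  rw [hv, ← emb_smul, ← emb_add] at h1 h2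
  generalize v.add (smul l1 r) = v1 at h1 h
  generalize v.add (smul l2 rt) = w at h2 h
  generalize st % 128 = d at h
  generalize st / 128 = st at h
  rcases d with _ | _ | _ | d
  · obtain ⟨h, -⟩ := cond_some h
    simp only [Bool.or_eq_true] at h
    rcases h with h | h
    · have := Tl.out_sound hκ h
      rw [G.hB, ← h1] at this
      exact this (G.H.inB _ _)
    · have := Tl.out_sound hκ h
      rw [G.hB, ← h2] at this
      exact this (G.H.inB _ _)
  · obtain ⟨h, -⟩ := cond_some h
    simp only [Bool.and_eq_true] at h
    obtain ⟨hb, h⟩ := h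
    have hbc := G.hbc hb
    have key : ∀ p q s, V i 1 = emb κ p → V i 2 = emb κ q → V i 0 = emb κ s → P.B.bcv p q s = true → False := by
      intro p q s hp hq hs h
      obtain ⟨m, hm⟩ := Tl.any_iff.1 h
      simp only [Bool.and_eq_true, Bool.or_eq_true] at hm
      have aux : ∀ p, (P.B.lm m.val p).zer = true → lam (Bt X) m (emb κ p) = 0 := by
        intro p hp
        rw [← G.hB, Tl.lm_eq, Z5.zer_ev hp]; simp
      rcases hm with ⟨hm, hm' | hm'⟩
      · exact hbc m i 1 (by decide) ⟨hp ▸ aux _ hm', by rw [show (1 : Fin 3) + 1 = 2 from rfl, hq]; exact aux _ hm⟩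
      · exact hbc m i 2 (by decide) ⟨hq ▸ aux _ hm, by rw [show (2 : Fin 3) + 1 = 0 from rfl, hs]; exact aux _ hm'⟩
    fin_cases k
    · exact key _ _ _ h1 h2 hv h
    · exact key _ _ _ hv h1 h2 h
    · exact key _ _ _ h2 hv h1 h
  · refine hsub _ _ _ ?_ h
    intro t ht
    rcases List.mem_cons.1 ht with rfl | ht
    · refine ⟨i, k, ?_⟩
      funext m
      fin_cases m
      · simp [embT, Tl.get, hv]
      · simp [embT, Tl.get, h1]
      · simp [embT, Tl.get, h2]
    · exact hL t ht
  · change (rd st fun y st => rd st fun z st => nth none L d fun t => cond (Par.ovl t v v1 w r n y z) (some st) none) = some st' at h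
    rw [rd_eq, rd_eq] at h
    obtain ⟨t, htL, h⟩ := nth_some h
    obtain ⟨h, -⟩ := cond_some h
    generalize st % 128 = y at h
    generalize st / 128 % 128 = z at h
    simp only [Par.ovl, Bool.and_eq_true, Nat.blt_eq] at h
    obtain ⟨hy, hz, hyz, hnl, hst⟩ := h
    obtain ⟨j, k', hj⟩ := hL t htL
    have hnl := Tl.nlex_sound hκ hnl
    rw [hj, lex_rotT] at hnl
    have e128 : (⟨128, 0⟩ : Z5).ev = 128 := by simp [Z5.ev]
    have hst := Tl.str_sound hκ (by rw [e128]; norm_num) hst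
    rw [hj, str_rotT, emb_add, emb_add, emb_smul, emb_smul, emb_smul, natZ_ev, natZ_ev, natZ_ev, e128] at hst
    have hy' : (0 : ℝ) < y := by exact_mod_cast hy
    have hz' : (0 : ℝ) < z := by exact_mod_cast hz
    have hyz' : (y : ℝ) + z < 128 := by exact_mod_cast hyz
    have hst2 := str_comb (S.posV i) k (x := (128 - y - z) / 128) (y := y / 128) (z := z / 128)
      (div_pos (by linarith) (by norm_num)) (by positivity) (by positivity) (by ring)
    have heq : (((128 - y - z) / 128 : ℝ) : ℂ) * V i k + ((y / 128 : ℝ) : ℂ) * V i (k + 1) + ((z / 128 : ℝ) : ℂ) * V i (k + 2)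
        = (((128 - (y + z) : ℕ) : ℝ) * emb κ v + (((y : ℝ) : ℂ) * emb κ v1 + ((z : ℝ) : ℂ) * emb κ w)) / ((128 : ℝ) : ℂ) := by
      rw [Nat.cast_sub hyz.le, hv, h1, h2]; push_cast; ring
    rw [heq] at hst2
    have := S.dis i j _ hst2 hst
    rw [← this] at hnl
    exact hnl hlex

theorem crs_zt {z : ℂ} (hz : z ≠ 0) : 0 < crs z (zt * z) := by
  have h1 : crs z (zt * z) = (√3 / 2) * Complex.normSq z := by
    simp [crs, zt, Complex.normSq_apply]; ring
  rw [h1]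
  have := Complex.normSq_pos.2 hz
  positivity

theorem node_sound (G : Good P κ ρ a b c X ea eb V) {sub : List Tl → ℕ → Option ℕ}
    (hsub : ∀ L st st', (∀ t ∈ L, isVal κ V t) → sub L st = some st' → False)
    {L : List Tl} (hL : ∀ t ∈ L, isVal κ V t) {st st' : ℕ}
    (h : P.node sub L st = some st') : False := by
  have hκ := G.hκ
  have S := G.H.S
  have hB := G.hB
  rw [Par.node, rd_eq, rd_eq, rd_eq, rd_eq] at h
  obtain ⟨tv, -, h⟩ := nth_some h
  simp only [frcP_eq, frcN_eq] at h
  generalize tv.get (st % 128 % 3) = v at h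
  generalize st / 128 % 128 / 6 = J at h
  generalize st / 128 % 128 % 6 = m at h
  generalize st / 128 / 128 % 128 = d1 at h
  generalize st / 128 / 128 / 128 % 128 = d2 at h
  generalize st / 128 / 128 / 128 / 128 = st at h
  obtain ⟨h0, h⟩ := cond_some h
  simp only [Bool.and_eq_true, Nat.ble_eq] at h0
  obtain ⟨hJ, hlB, hb1, hb2⟩ := h0
  have rA : emb κ (P.dir (J + 2) m) = ea * emb κ (P.dir (J + 1) m) := by
    rw [Par.dir, Par.dir, emb_rots, emb_rots, G.step (J + 1) (by omega)]; ring
  have rG : emb κ (P.dir (J + 1) (m + P.g)) = zt ^ P.g * emb κ (P.dir (J + 1) m) := by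
    rw [Par.dir, Par.dir, emb_rots, emb_rots]; ring
  have rB : emb κ (P.dir J (m + (3 - P.g))) = eb * emb κ (P.dir (J + 1) m) := by
    rw [Par.dir, Par.dir, emb_rots, emb_rots, G.step J (by omega)]
    have ang := G.H.ang
    have hz : zt ^ (3 - P.g) * zt ^ P.g = -1 := by
      rw [← pow_add, Nat.sub_add_cancel, zt_cube]
      rcases G.H.hg with h | h <;> omega
    have hz0 : zt ^ P.g ≠ 0 := pow_ne_zero _ zt_ne
    apply mul_left_cancel₀ hz0
    rw [pow_add]
    linear_combination zt ^ m * emb κ (P.tab.getD J zero) * hz - zt ^ m * emb κ (P.tab.getD J zero) * ang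
  have hr : ‖emb κ (P.dir (J + 1) m)‖ = ρ := by
    rw [Par.dir, emb_rots, norm_mul, norm_pow, zt_norm, G.nrm _ (by omega)]; simp
  generalize P.dir (J + 2) m = qA at h rA
  generalize P.dir J (m + (3 - P.g)) = qB at h rB
  generalize P.dir (J + 1) (m + P.g) = qG at h rG
  generalize P.dir (J + 1) m = r at *
  have hn : emb κ r.rot = zt * emb κ r := emb_rot r
  have hrn : 0 < crs (emb κ r) (emb κ r.rot) := by
    rw [hn]; apply crs_zt; intro h0; rw [h0] at hr; have := G.hρ; simp at hr; linarith
  generalize r.rot = n at *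
  obtain ⟨i, k, hlex, hv, t, ht, he⟩ := S.node (v := emb κ v) hrn (by rw [← hB]; exact Tl.lex_sound hκ hlB) (by
    unfold Par.blk1 at hb1
    by_cases hd : d1 < 3
    · rw [Nat.blt_eq.mpr hd] at hb1
      simp only [cond_true, Bool.and_eq_true] at hb1
      right
      refine ⟨⟨d1, hd⟩, ?_, ?_⟩
      · rw [← hB, Tl.lm_eq, Z5.zer_ev hb1.1, mul_zero]
      · rw [← hB, Tl.ed_eq, Z5.zer_ev hb1.2, mul_zero]
    · have hd' : Nat.blt d1 3 = false := by rw [← Bool.not_eq_true, Nat.blt_eq]; exact hd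
      rw [hd', cond_false] at hb1
      obtain ⟨t, htL, hb1⟩ := nth_true hb1
      rw [Bool.and_eq_true] at hb1
      obtain ⟨j, k', hj⟩ := hL t htL
      have h1 := Tl.lex_sound hκ hb1.1
      have h2 := Tl.nlex_sound hκ hb1.2
      rw [hj, lex_rotT] at h1 h2
      rw [emb_neg] at h1
      exact Or.inl ⟨j, h1, h2⟩) (by
    unfold Par.blk2 at hb2
    by_cases hd : d2 < 3
    · rw [Nat.blt_eq.mpr hd] at hb2
      simp only [cond_true, Bool.and_eq_true, Bool.or_eq_true] at hb2
      right
      refine ⟨⟨d2, hd⟩, ?_, ?_⟩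
      · rw [← hB, Tl.lm_eq, Z5.zer_ev hb2.1, mul_zero]
      · rw [← hB, Tl.ed_eq]
        rcases hb2.2 with h | h
        · exact (mul_pos (Tl.cpos hκ) (Z5.pos_ev h)).ne'
        · exact (Tl.neg_pos' hκ h).ne
    · have hd' : Nat.blt d2 3 = false := by rw [← Bool.not_eq_true, Nat.blt_eq]; exact hd
      rw [hd', cond_false] at hb2
      obtain ⟨t, htL, hb2⟩ := nth_true hb2
      simp only [Bool.and_eq_true] at hb2
      obtain ⟨j, k', hj⟩ := hL t htL
      have h1 := Tl.clo_sound hκ hb2.1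
      have h2 := Tl.nlex_sound hκ hb2.2.2
      have h3 := mul_pos (Tl.cpos hκ) (Z5.pos_ev hb2.2.1)
      rw [hj] at h1 h2
      rw [lex_rotT] at h2
      rw [clo_rotT] at h1
      refine Or.inl ⟨j, h1, ?_, h2⟩
      have e3 : (⟨3, 0⟩ : Z5).ev = 3 := by simp [Z5.ev]
      rw [Tl.dl, ← crs_emb, emb_sub, emb_add, emb_add, emb_smul, e3] at h3
      have a0 : emb κ t.p0 = V j (k' + 0) := congrFun hj 0
      have a1 : emb κ t.p1 = V j (k' + 1) := congrFun hj 1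
      have a2 : emb κ t.p2 = V j (k' + 2) := congrFun hj 2
      rw [a0, a1, a2, sum_rotT] at h3
      simpa using h3)
  have hop := G.H.opts G.ha G.hb G.hc hr ht he
  rw [← rA, ← rB, ← rG] at hop
  unfold Par.node1 at h
  simp only [Option.bind_eq_some_iff] at h
  obtain ⟨s1, g1, s2, g2, s3, g3, s4, g4, s5, g5, g6⟩ := h
  rcases hop with ⟨rfl, q1, q2⟩ | ⟨rfl, q1, q2⟩ | ⟨rfl, q1, q2⟩ | ⟨rfl, q1, q2⟩ | ⟨rfl, q1, q2⟩ | ⟨rfl, q1, q2⟩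
  · exact G.opt_sound hsub hL hlex hv q1 q2 g1
  · exact G.opt_sound hsub hL hlex hv q1 q2 g2
  · exact G.opt_sound hsub hL hlex hv q1 q2 g3
  · exact G.opt_sound hsub hL hlex hv q1 q2 g4
  · exact G.opt_sound hsub hL hlex hv q1 q2 g5
  · exact G.opt_sound hsub hL hlex hv q1 q2 g6

theorem chk_sound (G : Good P κ ρ a b c X ea eb V) (f : ℕ) : 
    ∀ L st st', (∀ t ∈ L, isVal κ V t) → P.chk f L st = some st' → False := by
  induction f with
  | zero => intro L st st' _ h; cases h
  | succ f ih => intro L st st' hL h; exact G.node_sound ih hL h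

theorem ok_false (G : Good P κ ρ a b c X ea eb V) {st : ℕ} (h : P.ok st = true) : False := by
  unfold Par.ok at h
  obtain ⟨st', h⟩ := Option.isSome_iff_exists.1 h
  exact G.chk_sound 40 [] st st' (by simp) h
end Good



theorem cert1 : Par.ok par1 0x4a801bb240d2a006ec9030000000060090404000691c0f909060000001001856c68280000c38e10080001db02010a3c082000351108000274415b2f0af53856c64283106820217b8217c6100853404100025008200e0d845a841c0220c000000018718201192811d0809dc203000000000180120e080051a0c100725c2df3a0d3a106f49030000000062cc04042790325a418010603020000000000c01208081802410100000004b440dac1067d68466782111210e9609004842e182030458202c460181045810227602166a10bcc0800002084428200000004a801bb240ddb3090588431702347e101822c1010001a4703e42418000000000190c85b4082830e30402000076c080828d0608000d4442000000000000c41808085ee085f1840414c03040839210080000001c3108e1604000018a202c100003b48304208820446f0446e4225761173908ada840608b04040005f3a0c00036d02228e116af0899284062ce04042790325a41821070102237822372112bb08b9c8456d420304582020208b02040828d00080000001c3108e1604000018a182c100003b4830420680040000000e58845ef0200000c50c16080000000000452c1bf5c0c00828181021034002000129a06a95839c601b4240c001280410000e95839e781ab900e81f06000940208000000000006009040400000000000300482020600904040005f3a0c00036d02228e116af0899284062cc04042790325a41821060002000000090242000000000002429a1608005280c1000094d0354ac1ce300da120600094020800074ac1cf3c0d5c80740f830004a0104000000000003004820200000000000180241010300482020400900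 = true := by decide +kernel

theorem cert2 : Par.ok par2 0xe89830000187381010000000000000000000018a3810100000c39c080800000e89830000187301010000000000000000000018a3010100000c39808081ef0852604410023a260e885067a1840600904042b30321801800db818cd00c600243415d3414ecc0ab5785744c1d10a0d3b60a0c01208083f4089aa84744c1d10a0e8ab080c01208092ba08c54043c7820ec81113b086918406009040495d0462a021e3c107640889d84348c2030048202011c78674cc22774112a7088c6039c141a15810180241010c00486820000000000000000150030400000000000000002a00608005340c1000000000000000000002a0060800000000000000005400c1000a681820014a03040000430141000000000000c50e0808000744c180000c38e0808000000000000e89830000187341010000000000000000000018a3410100000c39a0808c920d1038626883b41a1cf840e7d487765039b0a1c085400c11e481a2900c4d107683439f081cfa90eeca0736143810a801820210d050495d0462a021e3c11d130744283348c20302502022b6c1b4700d01b0c3340362e418c025068200034170c0006c1a18085380c10000000682e18000d8343010a701820214b03040008434141000000000000c5100808000744c180000c39008080000000c92091038426882b41a14f840a7d485765029b0a14105440c11e4812290084d105683429f0814fa90aeca0536142820a881820410e050495d0462a021e3c11d130744283348c20304582022b6c1b4700d01b083340362e418604583820003417080006c1a10105300c10000000682e10000d8342020a60182044490f04042100a0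8000000000000001054408100000000000000020a881020414e020400000000000000000020a88102000000000000000415102040829c04080822c0810008382820000000000000002150010400000000000000042a0020808534041000000000000000000042a002080000000000000008540041010a680820004a01040010438141000000000000c50c0808000744c180000c38c0808000000000000e89830000187301010000000000000000000018a3010100000c3980808c920d1038626883b41a1cf840e7d487765039b0a1c0053c0c11e481a2900c4d107683439f081cfa90eeca0736143800a781820010c050495d0462a021e3c11d130744283348c20300482022b6c1b4700d01b0c3340362e418c004868200034170c0006c1a18005340c10000000682e18000d8343000a681820014a03040000430141000000000000c50e0808000744c180000c38e080800000039090a3f585a0982ba260e885071d5850600904040000080ac280000c012080800001015850000180241013a260e88506000004630180000c01208081802410156341174208e8d84000004056140000600904046ec84000c012080ab1a08ba104746c200000202b0a000030048202376420006009040480d8590282e42210fd6091500446301ce0a0c0030048202120090a040020e0a08000000000000000854004100000000000000010a800820214d010400000000000000000010a80082000000000000000215001040429a020800128041020830282000000000000000414f0004000000000000000829e0008105300010000000000000000000829e0008000000000000001053c001020a600020400900 = true := by decide +kernel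

theorem cert3 : Par.ok (par3 8) 0x20400000000810000000020400000000810000da4070c68300000000628a040400000006a584f014313a010ec5087818c0808000005428f2e0800036901c31a0c000000018f1c101780a200000100703f4144800bcc408e02018710201000be0490d824c05120c1000174e8301146830000f4c08b9704062ca04041ba83378019b10503020000000000c78e0808a841c1410000000280828044222990314602a0060949a133c3090001404140221114c818a3015003045429a06089072814146560c0012804106e615e370a42f860000000000c48e080885f0a00000000c30e080800002107850400001041488205195830208b02041b98478dc240501800000000031e40202473028000000031840202000010a222c11954121930800a1008000000a60182060090404000000000000000018d1810100000c50c0808000061c608040000104146800400000000000000000020a90002000000000000000415200040829e00080000000000000000310602020000105300c100000008100037090b3c3873ab01c01c0c0000000187182010000fdc03011468346ac2612e112bb08ad184065cc04043b303572418c286068200000051a0c10000040c2140f9860c0408000000000104304000280508082a20409d1b0604000821820001402840415102040881c040b9860800000646c1800108503369020000000000c14e07040cc962c080451a0f6100c0005b300d7c10671c040000000000c51a080b313063ca1a200803934100401c0c0001fa476310201872c201008c3c2000000000005421c0a083052e0c1008440272181c0451a0c06f162000006211040417c0721b43860a881820658e04040151b06000351e0fc040a000000000305381c1033258b0200c8e83000230f07e02050000000001829c0e081992c58103267020201948080000085340c106025038200794030000000000c59808080000020c060400094020860024341000008298060801e500c00000000030e70202000010438141010000000000000004152000400000000000000082a400081053c001020a600020400900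 = true := by decide +kernel

theorem cert4 : Par.ok (par3 12) 0x2040000000000020408100000810000000020408100000810000000000000000020840a026af0b401851e15103054ce849e1830001042050135785a00c28f0a881821814e030400000006d203863419f66107e0088dd8448c02034050202011468351482008a341a77214f28071468334c03118c194310c796860698a04046a58558d828346502021b9821eaa101a0281010000000000000041085004d5e5280328f029e060a99d273c315000208428026af29401947814f0304e429806080000013b0351481808a341a77210f28071468334c02918c154310a796850680b04046a58458d82033a582021b9819eaa0c91a2c4c1008c3c9808a344514a0c0451a0d5ba08ba60439482306e1019d2c10108e60d8ca0648d1626099851ad01000000000000001902580532258f812d0829e060a28f2b882950000c812c029912c7c0968414f0304fc29806080000013b0351481808a341a77210f28071468334c02918c154310a796850698b04046a58458d820346582021b9819eaa0cc202c641008c3ca808a345514a0c0451a0d5ba08ba60439482306e101a32c10108e60d8ca06610163209c851ae8100000027606a290301146834ee421e500e28d066980523182a86214f2d0a0d3160808d4b08b1b04068cb0404373033d541984058c820118795011468aa2941808a341ab741174c087290460dc203465820211cc1b1940cc202c641390a35d0200000003204b00a644b1f025a1053c0c1451e571052a0001902580532258f812d0829e0609f85300c13c0a481820114683217c71e500e2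8d0685f8f05b47968e3d1bb1e0c50c080875d1c56a8e061c604041798d11c06b9083028200000008210a009abca500651e053c0c1533a4e7862a00041085004d5e5280328f029e0609c85300c1366a49982011468380a029e500e28d0700786353433c421a18c0c0c50e08092c50b11205061c704043b50441602210838282000000082106009abc6500631205400c1533a2e7861a00041083004d5e3280318902a00609085340c11e3a50d8201187840000da4070c68342dc221801143d0899a040680a04040228d0745284011468356e82ae9814e520ac1b85068ca04042398463282034050202217c2217e10c32084df045abc21d5a1018d2810110be110bf086190426f822d5e10ead080c6940808f1d286c1060a443820000ca8070880336901c31a0c00000001ae2c1011e500e28d07f0192fc049166211c9a087560380381ce4a50006ec521b8280c3901008bad091878407f09860a441822acc1b52c0c00000001b620c41035c5820200000000000c811002991107c08830151030514787c4143800064088014c8883e044180a881822a14e0304000000000000000001902440532244f8122cc2a0060a28f21882900000c812202991227c091661500304c029a06080451a0cda4070c68360d45651a24d5514ed58a064ca0404794038a3419b480e18d0600000000cb140808f280714683a68c5f1102847316ce38b0640a040446f0b0000000000cb1408088de1600000000019628101031a50202237858000000000658a040456b0a000173714ad08a064ca040446f0b0000000000cb140808ad6140002e6e295a1140c994080818a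2810100766c260324770b2213d11358c8860a5818200ecd84c0648ee164427a226b1910c14b030501909dc2840fd025fb6120c81408080000000c812202991227c09166150030514790c4148000064091014c8913e048b30a801826014d0304b43940808000008429106080000001a38080228d0674f05217c2ab52152180a0c30e0808c5008d19845a0c70404000004214883045d883744c1c0641f70a0c3f4077ed838314503826c541d1080e0320fb85061fa03bf6c1c18a2810118580df110701907dc2830fd01dfb60e0c5140e08bb106e898380c83ee14187e80efdb070628a07049020f0a080461e1c00036901c31a0d0b7088600450f422668101a928101008a341d14a100451a0d5ba0aba60539482b06e141ac2810108e6118ca080d494080885f0885f8430c82137c116af08756840658a040442f8442fc21864109be08b57843ab42032c502024e98a24043c29120080000000da4070c6833ecc20fc0111bb089180406a4a04040228d06a290401146834ee429e500e28d066980623183286218f2d0c0d7940808d4b0ab1b0506b0a0404373043d542035250202000000036901c31a0e2b10fd830817b43b0901c18828101008a34196580dc1106cdc88142c1a2060db39100c78e1608f280714683f01841e500e28d06b9f09ba5c494ba25b36120c714080893106c4e0366e44935a0df9006d9c89064870e0441c03607c1b37224eab07187836ce44832438702062ca040401e110e6d203863419b480e18d0600000000e590080bc05327158478502701c4c79d0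8bc48421b0d060a2c18232a02c22016e9d07ec1940dd419bc00c4882c181000000000072c804040cc900808000946c21b682183a093cc042414583040004a3610db410c1d049e602120a2c18200c1104aa8829b3a1210a08ae8850c1460304018220955105367424214115d10a1828c060b80c33ac6195c6024f0e130182f7c80619acd2b9868305160c1403068000000000396402020664804043c9902808ab306d4b0366e440f3a0d78906d9c88063c70b040c414080800000f088336901c31a0d9b91330f89297c4b672241921c10100000218d060000bc40d5be0600bcc06a9b83182078d0400003102420236d024222100431a1403c220d9b91800a5f18d9c8c061c70804006681652e0b121478a0418289060885f149990a0001a191460c0a06547040442f8944dc4b5582524412ad60906487040442f8a4cc850000d0c8a30605032a38202217c4a26e25aac129220956b04832438202061c708040230f200001b480e18d0685b8443002287a11334080e39208080451a0e8a5080228d06add055d3029ca4158370a0e512080847308c6504071c9040442f8442fc21864109be08b57843ab42036248202217c2217e10c32084df045abc21d5a101b12410145884a10254147ab04000000064091014c8913e048b30a801828a3c8620a400003204880a64489f0245985400c1300a681825a14a03040228d07014053ca01c51a0e00f0c6a6867884343181818a1c101258a162240a0c38e080876a0882c0454107050400000010420f013578fa00c7ad0a80182a67474f0c4000082107809abc7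d0063d685400c12a0a681824e98a24040230f0e0001b480e18d0685b8443002287a11334080d49408080451a0e8a5080228d06add055d3029ca4158370a0d614080847308c650406a4a040442f8442fc21864109be08b57843ab42032c50202217c2217e10c32084df045abc21d5a1019628101274c512021e1489004000000064088014c8883e044180a881828a3c3e20a1c0003204400a64441f0220c05440c1150a701822420b060465504864c21d5615d940a601051c7c2ad1414f020a242a20608a1009002843aac2bb2814c020a38f855a2829e0414485440c1060a7018206acb04040228d0642f903ca01c51a0d0bf220b6912d1c8a3764418a201010eba40ad5200c39008082f31e2380f1810805040000001042050135785a00c28f0a88182a67424f0c1800082102809abc2d00614785440c10c0a701821220b06041b98378dc1c050140000000003183820247302000000003123820200000871e20100000000000000000634804040000314402020000187202010000041052208101020000000000410c10000a0142020a88102746c181000208608000500a10105440810210701020000000000018b341010000000000620d040400000010430700028050e042a20609d1b0c04000821838001402870215103040429c060801e500c000000000310682020000085340c10602503820208b020465505864c29d5619d940c601061c7c32d1418f020c042a00608a100b002853aac33b2818c020c38f865a2831e0418085400c1010a681820c04a07041b98378dc1c050140000000003183020247302000000003123020200000071a201000000000000000006347040400003143820200001871c2010000040851e04101020000000000410c1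0000a0142010a80082746c181000208608000500a10085400410110680820000000000018b301010000000000620c040400000010430700028050e002a00609d1b0c04000821838001402870015003040029a060801e500c000000000310602020000005300c10600483820004a010465506864c31d561dd940e601071c7c3ad141cf020e0029e0608a100d002863aac3bb281cc020e38f875a2839e041c0053c0c1000a60182120090a04000010414683041b98378dc1c050140000000003184020247302000000003124020200001072220100000000000000000634604040000314302020000187182010000041051a001000000000000000000082a400080000000000000010548001020a780020000000000018a38101000000000061ce040400000000000000000020a90182000000000000000415203040829e06080000204000000000042a81800164784000019c3a741008a3419b5e0c000b23c280000cf9d4009a1706000591e14000067cea004794030002c8f0a000033e7500236bc1800164785000019f3a801033a602020002a9a08d620458282205812f1208dc40400106850400001002078604855030002c8f08000033874e822468c13041b98378dc1c050140000000003183020247302000000003123020200000071a201000000000000000006347040400003143820200001871c2010000040851e041000000000000000000042a60208000000000000000854c041010a800820000000000018a30101000000000061cc04040408102000000104304000280508002a00609d1b0604000821820001402840015003040041a080800002040000000caa070c9833aac23b2810c020838f845a2821e0410105440c114200e00506755847650218041071f08b45043c082020a881820464e0404000000000000000018d2010100000c5100808000061c808040000104148820400000000000000000020aa0102000000000000000415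40204082a2040800000000000628d04040000000001873410101020408000000410c10000a0142010a88182746c181000208608000500a10085440c101107020200000000003d840a01f180d44286181540304027860a0007b081403e301a8850c302a80608485440c1730c247611400000000018d341010000000000628d040400000000004e0e1803e301a8850c302a8060804f0c140009c1c3007c603510a18605500c1090a88182a454200766c280688830050b43fb081803e301e8850e3c2a8060b50e0b3c30600a1687f6103007c603d10a1c785500c10c0a8818200e488336901c31a0fd052a794038a3418000000036e58202000000000001b72c101000000000000db96080818a2c1010a160d103060017d06e5d033ca01c51a0cfae08dd80450e82264a1018b381010ed00db3f062441c1408000000000006dcb04040000000000410c1003e3012805081829e0609d1b073c30300020860801f1809402840c14f03040df1808080451a158af0d48d063d4433c4c18485302c100000000001ec21200f8c13a2149b30a98182013c3120003d842401f182744293661530304c02a0060a91508a290c0000000000c698080800000000031460202000179c073c38300000000640b050401d9b0801a220a0142d0dec20500f8c06a21430c0a98182d43824f0c140285a1bd840a01f180d44286181530304242a006080451a0cda4070c6830148d0b000019f3410100726820086341b18028014b4299ba140c41508080461e100451a19db615a078a2b74540622860434141060a54182296460000000000688d040400000000019f3410114b230000000000344682020000000000cf9a08081a23410178081403b3611db6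0da078615b8299ba14305380c13c662b191144b20a8eb05033868202f010280608823b6c18d9d090850433742860a7018278cc5632228964151d60a0670d04041a09a0e080009e983e1241c66d0eede871210a050401d9b0f2d383000301a0600375066f0031821006042790378f018f9a608020c14d030402f1414000030e6020236901c31a0c05e2828000061cc0404003ef06d2003685c180009db8400001c93b28113b40d5c1062639814080813ab01c01c0e12f09191042990240681018a242c15e22183f30643403002098604000000000187301014c381a8843574e833ca01c51a0d2b809252843d3022e5c1018b3c10106ea0cde0060041e0c0800000000030e6020200bcc2d05e021200ecd8401a07930000305380c11b480c000000000326682023ca01c51a0de330f8c88725903c7581c19334101237e1c0000000003266820246fc3800000000064cd04040cb1a08080000003d842401f18274429366153030402786240007b084803e304e88526cc2a60609805400c12d6a6970200794030000000000c41c08080000c14e03040da1608081872c201006e6c19b480e18d07e82953ca01c51a0c00000001b72c101000000000000db960808000000000006dcb04040c5160808bad07187830100708aa8819e500e28d0691d8478ac21f9a11630080c696080837606ae8832428b0b040000000000036e58202000000000020860801f1809402840c14f0304e8d839e18180010430400f8c04a0142060a7818206f8c04040228d0aedb09d03c48adc20cdd1024298160803b360c03444100285a167070a01f180b44285121520304d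8e849e1820050b42ce0e1403e30168850a242a406083053c0c1342e0c000f0105808a3443b6c3340f182b70b33745920a60182a8901fa080c5ee06b6603241ce0804000038676202010070a36901c31a0d9b90930f84297c236721018a2c1011e500e28d066d203863418000000031a582023ca01c51a0eb210b8c88511cc2b194141962c10110be1400000000031a58202217c28000000000634b04040c996080885f0a00000000018d2c10110be10000491022b581018a2c10110be1400000000031a58202217c200009220456b020314582023040b110401a22080142d0b3838500f8c05a2142890a901826c7424f0c100285a167070a01f180b442851215203041829e06081c130101003ca018000000000620e0404000060a7018206d0b04040c396100803444180285a1fd840c01f180f442871e1540305a87059e1830050b43fb081803e301e8850e3c2a80608605440c1093a705023a801c5140c00032a824224100006af01ba361096006ddd030cecc0704547040000305220c11b481218d0800f28060000000001883810100001829c06081ae2c101000fbc1b4800da1706000276e10000067cda0044ed0357041893a7050200ecd850204caf0675d0368ac19f4c0c1082e181342e0c00072ac200000cf9b400808134841a1680df9f0680d830420b86040409a580ceba06d55034090182105c3021274e0a0440f03562c180007430398703d10836e9d06794038a341a570124a5087a6045cb82031c882020dd419bc00c10b442410000000000c14e07040d7165608128386410001f018cfc046000000000000000f0a5c882011878607f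068c0a441820003a0a1a0228d06030131c00003107020203f8685f434605380c109085828200000009c1c3007c603510a18605500c1009e18280013838600f8c06a21430c0aa01821215103041829c060801e500c000000000314682020000187341011b480e18d0600f280600000000018a3410100000c39a080800042a8180009db8400001a2328c1008a341b48011a1706000276e140000694ca6044ed045704203466820207e8187ec0cc203464101027560380381c25e12322085320480d02031450582fa08507e60c86806044150c0800000000030e68202dc205d10836e9d06794038a341a570124a5087a6045cb820316802020dd419bc00c08840181000000000061cd04040441a0c09ea0060151b086d20386341fa0a44f280714683000000006acb04040000000000035658202000000000001ab2c101030e5820220ac2351e100000002086093ce0494cc2500a10485240c10001043049e7024a661280508242920608000000000082182007c602500a103053c0c13a360e78606000410c1003e3012805081829e06081b530101008a341d70a14034440c0285a127070801f1809442840c1520304d8e839e1818050b424e0e1003e301288508182a406081883c101009674180003041c0c08ca80b0880536901800000000061ce0404d0b840000f280914684a8901fa080c5ee06b66030c28e0704000067475d8207cca800000000061ce04040f9950000000000c39c080848e3828100726825840180461e10ca80d08806ce50223460e50a06cdc85987c294be15b390a0c3160808279084f5041844e0d0418293060ab850a01a22060142d093838400f8c04a2142060a901826c741cf0c0c0285a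127070801f1809442840c15203040c41e080804b3a0c0001820e06040da980a0832b2c1c1008a3418ec010f2807146831ac8282da148320a414850640b04043ec8421402031a582020bcc188e00c78a2c2c106085828296742510822c1a0ad2105523429f5a16d920ac85850415403049d0840000a990a6db05885829b28141053a0c1583415a420aa46853eb42db241590b0a082a80608105440c132140c081326821c6412515087ca840414b830440f03562c18000743039674351082ae9d069d0860dd419bc00c10b442410000000000c14e07040d296440811f3840100000007b081403e301a8850c302a8060804f0c14000f6102807c603510a18605500c1090a881820c38e0704540942c0801e500c00000000030e68202000008434141010000000000000004154020400000000000000082a8040810544081020a701020208b0204540122c0801e500c00000000030e60202000000430141010000000000000002153010400000000000000042a6020808540041010a680820004a01040400000000000000105480c100000000000000020a901820414f030408298060801e500c00000000030e70202000010438141010000000000000004152000400000000000000082a400081053c001020a600020400900 = true := by decide +kernel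


open P5

theorem mkGood {N : ℕ} (P : Par) (μ : ℕ) (hμ : 0 < μ) {κ a b c X : ℝ} {ea eb : ℂ} {V : Fin N → Fin 3 → ℂ}
    (H : Setup N a b c X ea eb P.g V) (hκ : 0 < κ) (ha : a = κ * P.a.ev) (hb : b = κ * P.b.ev) (hc : c = κ * P.c.ev)
    (hX : X * μ = κ * P.X.ev) (h4 : P.tab.getD 4 zero = ⟨⟨μ, 0⟩, ⟨0, 0⟩⟩)
    (hs : ∀ J < 8, smul P.c (P.tab.getD J zero) =
      sub (smul P.b (P.tab.getD (J + 1) zero)) (smul P.a (rots P.g (P.tab.getD (J + 1) zero))))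
    (hbc : P.bc = true → Setup.Hbc X V) : Good P (κ / μ) κ a b c X ea eb V := by
  have hμ' : (0 : ℝ) < μ := by exact_mod_cast hμ
  have step : ∀ J < 8, emb (κ / μ) (P.tab.getD (J + 1) zero) = ea * emb (κ / μ) (P.tab.getD J zero) := by
    intro J hJ
    have h1 := congrArg (emb (κ / μ)) (hs J hJ)
    rw [emb_smul, emb_sub, emb_smul, emb_smul, emb_rots] at h1
    have tri := H.tri
    rw [H.eb_eq, ha, hb, hc] at tri
    have hc0 : (P.c.ev : ℂ) ≠ 0 := by
      have := H.hc
      rw [hc] at this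
      have := pos_of_mul_pos_right this hκ.le
      exact_mod_cast this.ne'
    have hk0 : (κ : ℂ) ≠ 0 := by exact_mod_cast hκ.ne'
    push_cast at tri
    have tri' : (P.c.ev : ℂ) = ea * (P.b.ev - P.a.ev * zt ^ P.g) := by
      apply mul_left_cancel₀ hk0
      linear_combination tri
    apply mul_left_cancel₀ hc0
    linear_combination (-ea) * h1 + emb (κ / μ) (P.tab.getD (J + 1) zero) * tri'
  refine ⟨H, by positivity, hκ, by rw [ha]; ring, by rw [hb]; ring, by rw [hc]; ring, ?_, step, ?_, hbc⟩
  · field_simp; linarith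
  · have h1 : ∀ J < 8, ‖emb (κ / μ) (P.tab.getD (J + 1) zero)‖ = ‖emb (κ / μ) (P.tab.getD J zero)‖ := by
      intro J hJ
      rw [step J hJ, norm_mul, H.na, one_mul]
    have h2 : ∀ J < 8, ‖emb (κ / μ) (P.tab.getD J zero)‖ = ‖emb (κ / μ) (P.tab.getD 0 zero)‖ := by
      intro J
      induction J with
      | zero => intro _; rfl
      | succ J ih => intro hJ; rw [h1 J (by omega), ih (by omega)]
    intro J hJ
    rw [h2 J hJ, ← h2 4 (by norm_num), h4]
    simp [emb, Z5.ev, abs_of_pos hκ]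
    field_simp

theorem Setup.big_lt {N : ℕ} {a b c X : ℝ} {ea eb : ℂ} {g : ℕ} {V : Fin N → Fin 3 → ℂ}
    (H : Setup N a b c X ea eb g V) (hlt : a < b) : 40 ≤ N := by
  by_contra hN
  obtain ⟨κ, hκ, ⟨rfl, ha, hb, hc, hX⟩ | ⟨rfl, ha, hb, hc, hX⟩ | ⟨rfl, ha, hb, hc, hX, hbc⟩⟩ := H.reduce_lt (by omega) hlt
  · have := mkGood par1 2401 (by norm_num) H hκ (by rw [ha]; simp [par1, Z5.ev]) (by rw [hb]; simp [par1, Z5.ev])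
      (by rw [hc]; simp [par1, Z5.ev]) (by rw [hX]; simp [par1, Z5.ev]; ring) rfl
      (by intro J hJ; interval_cases J <;> rfl) (by intro h; cases h)
    exact this.ok_false cert1
  · have := mkGood par2 2401 (by norm_num) H hκ (by rw [ha]; simp [par2, Z5.ev]) (by rw [hb]; simp [par2, Z5.ev])
      (by rw [hc]; simp [par2, Z5.ev]) (by rw [hX]; simp [par2, Z5.ev]; ring) rfl
      (by intro J hJ; interval_cases J <;> rfl) (by intro h; cases h)
    exact this.ok_false cert2
  · have key : ∀ x : ℕ, X = κ * x → Good (par3 x) (κ / (32 : ℕ)) κ a b c X ea eb V := fun x hX =>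
      mkGood (par3 x) 32 (by norm_num) H hκ (by rw [ha]; congr 1; simp [par3, Z5.ev]; ring) (by rw [hb]; congr 1; simp [par3, Z5.ev]; ring)
      (by rw [hc]; simp [par3, Z5.ev]) (by rw [hX]; simp [par3, Z5.ev]; ring) rfl
      (by intro J hJ; interval_cases J <;> rfl) (fun _ => hbc)
    rcases hX with hX | hX
    · exact (key 8 (by rw [hX]; norm_num)).ok_false cert3
    · exact (key 12 (by rw [hX]; norm_num)).ok_false cert4

theorem Setup.big {N : ℕ} {a b c X : ℝ} {ea eb : ℂ} {g : ℕ} {V : Fin N → Fin 3 → ℂ}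
    (H : Setup N a b c X ea eb g V) : 40 ≤ N := by
  rcases lt_or_gt_of_ne H.ne_ab with h | h
  · exact H.big_lt h
  · exact H.swap.big_lt h



theorem hull_iff {V : Fin 3 → ℂ} (hV : 0 < lam V 0 (V 2)) (z : ℂ) :
    z ∈ convexHull ℝ (Set.range V) ↔ CloIn V z := by
  constructor
  · intro h
    have hc : Convex ℝ {z | CloIn V z} := by
      intro x hx y hy s t hs ht hst k
      have e : lam V k (s • x + t • y) = s * lam V k x + t * lam V k y := by
        obtain rfl : s = 1 - t := by linarith
        simp [lam, crs]; ring
      have h1 := hx k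
      have h2 := hy k
      rw [e]; positivity
    exact convexHull_min (by rintro _ ⟨m, rfl⟩; exact clo_vert hV m) hc h
  · intro h
    have e0 : lam V 1 z + lam V 2 z + lam V 0 z = lam V 0 (V 2) := by
      simp [lam, crs]; ring
    have e1 : z = ∑ k : Fin 3, (lam V (k + 1) z / lam V 0 (V 2)) • V k := by
      have h3 : (lam V 0 (V 2) : ℝ) • z = ∑ k : Fin 3, (lam V (k + 1) z) • V k := by
        rw [Fin.sum_univ_three]
        apply Complex.ext <;> simp [lam, crs] <;> ring
      calc z = (lam V 0 (V 2))⁻¹ • ((lam V 0 (V 2) : ℝ) • z) := by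
            rw [smul_smul, inv_mul_cancel₀ hV.ne', one_smul]
        _ = _ := by
            rw [h3, Finset.smul_sum]
            refine Finset.sum_congr rfl fun k _ => ?_
            rw [smul_smul]; congr 1; field_simp
    rw [e1]
    refine (convex_convexHull ℝ _).sum_mem (fun k _ => div_nonneg (h _) hV.le) ?_
      (fun k _ => subset_convexHull ℝ _ ⟨k, rfl⟩)
    rw [← Finset.sum_div, Fin.sum_univ_three, div_eq_one_iff_eq hV.ne', ← e0]
    rfl

theorem str_interior {V : Fin 3 → ℂ} (hV : 0 < lam V 0 (V 2)) {z : ℂ} (h : StrIn V z) :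
    z ∈ interior (convexHull ℝ (Set.range V)) := by
  refine mem_interior.2 ⟨{z | StrIn V z}, fun y hy => (hull_iff hV y).2 (StrIn.clo hy), ?_, h⟩
  have : {z | StrIn V z} = ⋂ k, {z | 0 < lam V k z} := by ext; simp [StrIn]
  rw [this]
  refine isOpen_iInter_of_finite fun k => isOpen_lt continuous_const ?_
  unfold lam crs
  simp only [Complex.sub_re, Complex.sub_im]
  fun_prop

theorem tile_norm {U : Fin 3 → ℂ} {a b c : ℝ} {ea eb : ℂ} (ha : 0 < a) (hb : 0 < b) (hc : 0 < c)
    (na : ‖ea‖ = 1) (nb : ‖eb‖ = 1) (ia : 0 < ea.im) (ib : 0 < eb.im)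
    (tri : (c : ℂ) = a * eb⁻¹ + b * ea)
    (h01 : dist (U 0) (U 1) = c) (h12 : dist (U 1) (U 2) = a) (h02 : dist (U 0) (U 2) = b) :
    ∃ V : Fin 3 → ℂ, Set.range V = Set.range U ∧ 0 < lam V 0 (V 2) ∧
      ∃ u : ℂ, ‖u‖ = 1 ∧ V 1 = V 0 + c * u ∧ (V 2 = V 0 + b * u * ea ∨ V 2 = V 0 + a * u * eb) := by
  have hc' : (c : ℂ) ≠ 0 := by exact_mod_cast hc.ne'
  obtain ⟨u, hu⟩ : ∃ u : ℂ, u = (U 1 - U 0) / c := ⟨_, rfl⟩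
  have hU1 : U 1 = U 0 + c * u := by rw [hu]; field_simp; ring
  have nu : ‖u‖ = 1 := by
    rw [hu, norm_div, ← dist_eq_norm, dist_comm, h01, Complex.norm_real, norm_of_nonneg hc.le,
      div_self hc.ne']
  have hu0 : u ≠ 0 := by rintro rfl; simp at nu
  obtain ⟨z, hz⟩ : ∃ z : ℂ, z = (U 2 - U 0) / u := ⟨_, rfl⟩
  have hU2 : U 2 = U 0 + u * z := by rw [hz]; field_simp; ring
  have nz : ‖z‖ = b := by rw [hz, norm_div, ← dist_eq_norm, dist_comm, h02, nu, div_one]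
  have nz2 : ‖z - c‖ = a := by
    rw [← h12, hU1, hU2, dist_comm, dist_eq_norm]
    have : U 0 + u * z - (U 0 + c * u) = u * (z - c) := by ring
    rw [this, norm_mul, nu, one_mul]
  have q1 : z.re ^ 2 + z.im ^ 2 = b ^ 2 := by
    rw [← nz, ← Complex.normSq_eq_norm_sq, Complex.normSq_apply]; ring
  have q2 : (z.re - c) ^ 2 + z.im ^ 2 = a ^ 2 := by
    rw [← nz2, ← Complex.normSq_eq_norm_sq, Complex.normSq_apply]; simp; ring
  have q3 : ea.re ^ 2 + ea.im ^ 2 = 1 := by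
    have := Complex.normSq_eq_norm_sq ea
    rw [na, Complex.normSq_apply] at this; linarith
  have q4 : eb.re ^ 2 + eb.im ^ 2 = 1 := by
    have := Complex.normSq_eq_norm_sq eb
    rw [nb, Complex.normSq_apply] at this; linarith
  have t1 : c = a * eb.re + b * ea.re := by
    rw [unit_inv nb] at tri
    simpa using congrArg Complex.re tri
  have t2 : a * eb.im = b * ea.im := by
    rw [unit_inv nb] at tri
    have := congrArg Complex.im tri
    simp at this; linarith
  have zr : z.re = b * ea.re := by
    have h1 : 2 * c * z.re = b ^ 2 - a ^ 2 + c ^ 2 := by linarith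
    have h2 : 2 * c * (b * ea.re) = b ^ 2 - a ^ 2 + c ^ 2 := by
      have h3 : a ^ 2 = (c - b * ea.re) ^ 2 + (b * ea.im) ^ 2 := by
        rw [← t2, t1]; linear_combination -a ^ 2 * q4
      rw [h3]; linear_combination b ^ 2 * q3
    have : 2 * c * z.re = 2 * c * (b * ea.re) := by rw [h1, h2]
    exact mul_left_cancel₀ (by positivity) this
  have zi : z.im = b * ea.im ∨ z.im = -(b * ea.im) := by
    apply sq_eq_sq_iff_eq_or_eq_neg.1
    rw [zr] at q1
    linear_combination q1 - b ^ 2 * q3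
  have uu : u.re ^ 2 + u.im ^ 2 = 1 := by
    have := Complex.normSq_eq_norm_sq u
    rw [nu, Complex.normSq_apply] at this; linarith
  rcases zi with zi | zi
  · have hz' : z = b * ea := by apply Complex.ext <;> simp [zr, zi]
    refine ⟨U, rfl, ?_, u, nu, hU1, Or.inl (by rw [hU2, hz']; ring)⟩
    have : lam U 0 (U 2) = c * b * ea.im * (u.re ^ 2 + u.im ^ 2) := by
      simp only [lam, crs, zero_add, hU1, hU2, hz']
      simp; ring
    rw [this, uu]; positivity
  · have hV2 : U 2 = U 1 + a * (-u) * eb := by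
      rw [hU1, hU2]
      have : z = c - a * eb := by
        apply Complex.ext
        · simp [zr]; linarith
        · simp [zi]; linarith
      rw [this]; ring
    refine ⟨![U 1, U 0, U 2], ?_, ?_, -u, by simpa using nu, ?_, Or.inr ?_⟩
    · ext w
      simp only [Set.mem_range, Fin.exists_fin_succ, Fin.exists_fin_zero_pi]
      simp
      tauto
    · have hU0 : U 0 = U 1 + c * (-u) := by rw [hU1]; ring
      have : lam ![U 1, U 0, U 2] 0 (U 2) = c * a * eb.im * (u.re ^ 2 + u.im ^ 2) := by
        simp only [lam, crs, zero_add, hV2, Matrix.cons_val_zero, Matrix.cons_val_one, hU0]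
        simp; ring
      show 0 < lam ![U 1, U 0, U 2] 0 (U 2)
      rw [this, uu]; positivity
    · show U 0 = U 1 + c * (-u)
      rw [hU1]; ring
    · exact hV2

theorem equi_map {A B C : Pt} {X : ℝ} (hX : 0 < X) (h1 : dist A B = X) (h2 : dist A C = X)
    (h3 : dist B C = X) :
    ∃ Φ : Pt ≃ᵃⁱ[ℝ] ℂ, Φ A = 0 ∧ Φ B = X ∧ Φ C = X * zt := by
  let L : Pt ≃ₗᵢ[ℝ] ℂ := Complex.orthonormalBasisOneI.repr.symm
  have hXc : (X : ℂ) ≠ 0 := by exact_mod_cast hX.ne'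
  obtain ⟨w, hw⟩ : ∃ w : ℂ, w = (L B - L A) / X := ⟨_, rfl⟩
  have nw : ‖w‖ = 1 := by
    rw [hw, norm_div, ← dist_eq_norm, L.dist_map, dist_comm, h1, Complex.norm_real,
      norm_of_nonneg hX.le, div_self hX.ne']
  have hw0 : w ≠ 0 := by rintro rfl; simp at nw
  have nw' : ‖w⁻¹‖ = 1 := by rw [norm_inv, nw, inv_one]
  let r : Circle := ⟨w⁻¹, by simpa [Submonoid.unitSphere] using nw'⟩
  let Φ : Pt ≃ᵃⁱ[ℝ] ℂ := L.toAffineIsometryEquiv.trans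
    ((AffineIsometryEquiv.constVAdd ℝ ℂ (-L A)).trans (rotation r).toAffineIsometryEquiv)
  have hΦ : ∀ p, Φ p = w⁻¹ * (L p - L A) := by
    intro p
    show w⁻¹ * (-L A + L p) = _
    ring
  have fA : Φ A = 0 := by rw [hΦ]; simp
  have fB : Φ B = X := by
    rw [hΦ]
    have : L B - L A = w * X := by rw [hw]; field_simp
    rw [this]; field_simp
  have g1 : ‖Φ C‖ = X := by
    rw [← h2, ← Φ.dist_map, fA, dist_comm, dist_zero_right]
  have g2 : ‖Φ C - X‖ = X := by
    conv_rhs => rw [← h3, ← Φ.dist_map, fB, dist_comm, dist_eq_norm]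
  obtain ⟨z, hz⟩ : ∃ z, z = Φ C := ⟨_, rfl⟩
  rw [← hz] at g1 g2
  have q1 : z.re ^ 2 + z.im ^ 2 = X ^ 2 := by
    rw [← g1, ← Complex.normSq_eq_norm_sq, Complex.normSq_apply]; ring
  have q2 : (z.re - X) ^ 2 + z.im ^ 2 = X ^ 2 := by
    have := Complex.normSq_eq_norm_sq (z - X)
    rw [g2, Complex.normSq_apply] at this
    simp at this; linarith
  have zr : z.re = X / 2 := by
    have : X * (2 * z.re) = X * X := by linarith
    have := mul_left_cancel₀ hX.ne' this
    linarith
  have s3 : √3 ^ 2 = 3 := Real.sq_sqrt (by norm_num)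
  have zi : z.im = X * (√3 / 2) ∨ z.im = -(X * (√3 / 2)) := by
    apply sq_eq_sq_iff_eq_or_eq_neg.1
    rw [zr] at q1
    linear_combination q1 - X ^ 2 / 4 * s3
  rcases zi with zi | zi
  · refine ⟨Φ, fA, fB, ?_⟩
    rw [← hz]
    apply Complex.ext <;> simp [zt, zr, zi] <;> ring
  · refine ⟨Φ.trans Complex.conjLIE.toAffineIsometryEquiv, ?_, ?_, ?_⟩
    · show (starRingEnd ℂ) (Φ A) = 0
      rw [fA]; simp
    · show (starRingEnd ℂ) (Φ B) = X
      rw [fB]; simp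
    · show (starRingEnd ℂ) (Φ C) = X * zt
      rw [← hz]
      apply Complex.ext <;> simp [zt, zr, zi] <;> ring

theorem image_triSet (Φ : Pt ≃ᵃⁱ[ℝ] ℂ) (T : Tri) :
    Φ '' triSet T = convexHull ℝ (Set.range fun k => Φ (T k)) := by
  have := AffineMap.image_convexHull (Φ.toAffineEquiv.toAffineMap : Pt →ᵃ[ℝ] ℂ) (Set.range T)
  rw [← Set.range_comp] at this
  exact this

theorem image_interior_triSet (Φ : Pt ≃ᵃⁱ[ℝ] ℂ) (T : Tri) :
    Φ '' interior (triSet T) = interior (convexHull ℝ (Set.range fun k => Φ (T k))) := by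
  rw [← image_triSet]
  exact Φ.toHomeomorph.image_interior _

theorem lamBt {X : ℝ} (hX : 0 < X) : 0 < lam (Bt X) 0 (Bt X 2) := by
  have : lam (Bt X) 0 (Bt X 2) = X * X * (√3 / 2) := by
    simp [lam, crs, Bt, zt]; ring
  rw [this]; positivity

theorem zt_exp : zt = Complex.exp ((π / 3 : ℝ) * Complex.I) := by
  apply Complex.ext
  · rw [Complex.exp_ofReal_mul_I_re, cos_pi_div_three]; rfl
  · rw [Complex.exp_ofReal_mul_I_im, sin_pi_div_three]; rfl

theorem tile_data {T : Tri} (hT : IsTriangle T) {α β γ : ℝ} (h : HasAngles T α β γ) :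
    0 < dist (T 1) (T 2) ∧ 0 < dist (T 0) (T 2) ∧ 0 < dist (T 0) (T 1) ∧
    0 < sin α ∧ 0 < sin β ∧ α + β + γ = π ∧
    dist (T 0) (T 1) = dist (T 1) (T 2) * cos β + dist (T 0) (T 2) * cos α ∧
    dist (T 1) (T 2) * sin β = dist (T 0) (T 2) * sin α := by
  obtain ⟨rfl, rfl, rfl⟩ := h
  have e0 : triAngle T 0 = ∠ (T 1) (T 0) (T 2) := rfl
  have e1 : triAngle T 1 = ∠ (T 2) (T 1) (T 0) := rfl
  have e2 : triAngle T 2 = ∠ (T 0) (T 2) (T 1) := rfl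
  have inj := hT.injective
  have n01 : T 0 ≠ T 1 := fun e => absurd (inj e) (by decide)
  have n12 : T 1 ≠ T 2 := fun e => absurd (inj e) (by decide)
  have n02 : T 0 ≠ T 2 := fun e => absurd (inj e) (by decide)
  have nc : ¬ Collinear ℝ {T 0, T 1, T 2} := by
    rw [← affineIndependent_iff_not_collinear_set]
    have : ![T 0, T 1, T 2] = T := by ext k; fin_cases k <;> rfl
    rw [this]; exact hT
  have nc0 : ¬ Collinear ℝ {T 1, T 0, T 2} := by rwa [Set.insert_comm]
  have nc1 : ¬ Collinear ℝ {T 2, T 1, T 0} := by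
    have : ({T 2, T 1, T 0} : Set Pt) = {T 0, T 1, T 2} := by
      ext; simp; tauto
    rwa [this]
  have d01 := dist_pos.2 n01
  have d12 := dist_pos.2 n12
  have d02 := dist_pos.2 n02
  rw [e0, e1, e2]
  refine ⟨d12, d02, d01, sin_pos_of_not_collinear nc0, sin_pos_of_not_collinear nc1, ?_, ?_, ?_⟩
  · have := EuclideanGeometry.angle_add_angle_add_angle_eq_pi (T 2) (p₂ := T 0) (p₁ := T 1) n01
    rw [EuclideanGeometry.angle_comm (T 0) (T 2) (T 1)] at *
    rw [EuclideanGeometry.angle_comm (T 2) (T 1) (T 0)] at *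
    first
      | linarith
      | (rw [EuclideanGeometry.angle_comm (T 1) (T 2) (T 0), EuclideanGeometry.angle_comm (T 0) (T 1) (T 2)] at *; linarith)
  · have l1 := EuclideanGeometry.law_cos (T 1) (T 0) (T 2)
    have l2 := EuclideanGeometry.law_cos (T 2) (T 1) (T 0)
    rw [dist_comm (T 1) (T 0), dist_comm (T 2) (T 0)] at l1
    rw [dist_comm (T 2) (T 0), dist_comm (T 2) (T 1)] at l2
    apply mul_left_cancel₀ d01.ne'
    linarith
  · have l := EuclideanGeometry.law_sin (T 0) (T 1) (T 2)
    rw [EuclideanGeometry.angle_comm (T 2) (T 0) (T 1), EuclideanGeometry.angle_comm (T 0) (T 1) (T 2),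
      dist_comm (T 2) (T 0)] at l
    linarith

theorem main40 (N : ℕ) (ABC T : Tri)
    (hABC : IsTriangle ABC) (hT : IsTriangle T)
    (heq : IsEquilateral ABC)
    (α β γ : ℝ) (hangles : HasAngles T α β γ)
    (hγ : γ = π / 3 ∨ γ = 2 * π / 3)
    (hirr : ¬ ∃ q : ℚ, α = (q : ℝ) * π)
    (tiles : Fin N → Tri) (ht : IsTiling N ABC T tiles) :
    40 ≤ N := by
  obtain ⟨ha, hb, hc, sa, sb, hsum, hcc, hss⟩ := tile_data hT hangles
  set a := dist (T 1) (T 2)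
  set b := dist (T 0) (T 2)
  set c := dist (T 0) (T 1)
  obtain ⟨X, hXd⟩ : ∃ X, X = dist (ABC 0) (ABC 1) := ⟨_, rfl⟩
  have hX : 0 < X := by
    rw [hXd]
    exact dist_pos.2 fun e => absurd (hABC.injective e) (by decide)
  obtain ⟨Φ, f0, f1, f2⟩ := equi_map hX hXd.symm (heq.2 ▸ hXd.symm) (heq.1 ▸ hXd.symm)
  have fB : (fun k => Φ (ABC k)) = Bt X := by
    ext k; fin_cases k
    · exact f0
    · exact f1
    · exact f2
  obtain ⟨ea, hea⟩ : ∃ e, e = Complex.exp ((α : ℂ) * Complex.I) := ⟨_, rfl⟩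
  obtain ⟨eb, heb⟩ : ∃ e, e = Complex.exp ((β : ℂ) * Complex.I) := ⟨_, rfl⟩
  have na : ‖ea‖ = 1 := by rw [hea, Complex.norm_exp_ofReal_mul_I]
  have nb : ‖eb‖ = 1 := by rw [heb, Complex.norm_exp_ofReal_mul_I]
  have ar : ea.re = cos α := by rw [hea, Complex.exp_ofReal_mul_I_re]
  have ai : ea.im = sin α := by rw [hea, Complex.exp_ofReal_mul_I_im]
  have br : eb.re = cos β := by rw [heb, Complex.exp_ofReal_mul_I_re]
  have bi : eb.im = sin β := by rw [heb, Complex.exp_ofReal_mul_I_im]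
  have tri : (c : ℂ) = a * eb⁻¹ + b * ea := by
    rw [unit_inv nb]
    apply Complex.ext
    · simp [ar, br]; linarith
    · simp [ai, bi]; linarith
  obtain ⟨g, hg, hgγ⟩ : ∃ g : ℕ, (g = 1 ∨ g = 2) ∧ γ = g * (π / 3) := by
    rcases hγ with h | h
    · exact ⟨1, Or.inl rfl, by rw [h]; push_cast; ring⟩
    · exact ⟨2, Or.inr rfl, by rw [h]; push_cast; ring⟩
  have ang : ea * eb * zt ^ g = -1 := by
    rw [hea, heb, zt_exp, ← Complex.exp_nat_mul, ← Complex.exp_add, ← Complex.exp_add,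
      ← Complex.exp_pi_mul_I]
    congr 1
    have : (π : ℂ) = α + β + g * ((π / 3 : ℝ) : ℂ) := by
      have h : π = α + β + g * (π / 3) := by rw [← hgγ, hsum]
      exact_mod_cast h
    conv_rhs => rw [this]
    ring
  have irr : ∀ n : ℤ, n ≠ 0 → ea ^ n ≠ 1 := by
    intro n hn h
    rw [hea, ← Complex.exp_int_mul, Complex.exp_eq_one_iff] at h
    obtain ⟨m, hm⟩ := h
    have h1 : (n : ℂ) * α = m * (2 * π) := by
      apply mul_right_cancel₀ Complex.I_ne_zero
      linear_combination hm
    have h2 : (n : ℝ) * α = m * (2 * π) := by exact_mod_cast h1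
    apply hirr
    refine ⟨(2 * m : ℚ) / n, ?_⟩
    have hn' : (n : ℝ) ≠ 0 := by exact_mod_cast hn
    push_cast
    field_simp
    linarith
  have key : ∀ i, ∃ V : Fin 3 → ℂ, Set.range V = Set.range (fun k => Φ (tiles i k)) ∧
      0 < lam V 0 (V 2) ∧ ∃ u : ℂ, ‖u‖ = 1 ∧ V 1 = V 0 + c * u ∧
      (V 2 = V 0 + b * u * ea ∨ V 2 = V 0 + a * u * eb) := by
    intro i
    obtain ⟨σ, hσ⟩ := ht.congr i
    have hd : ∀ p q, dist (Φ (tiles i (σ.symm p))) (Φ (tiles i (σ.symm q))) = dist (T p) (T q) := by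
      intro p q
      rw [Φ.dist_map, hσ]; simp
    obtain ⟨V, hr, h⟩ := tile_norm (U := fun k => Φ (tiles i (σ.symm k))) ha hb hc na nb
      (by rw [ai]; exact sa) (by rw [bi]; exact sb) tri (hd 0 1) (hd 1 2) (hd 0 2)
    refine ⟨V, ?_, h⟩
    rw [hr]
    exact σ.symm.surjective.range_comp (fun k => Φ (tiles i k))
  choose V hr hp htile using key
  have S : TileSys N (Bt X) V := by
    refine ⟨lamBt hX, hp, ?_, ?_⟩
    · intro z
      rw [← hull_iff (lamBt hX), ← fB, ← image_triSet, ← ht.cover, Set.image_iUnion, Set.mem_iUnion]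
      refine exists_congr fun i => ?_
      rw [← hull_iff (hp i), hr, ← image_triSet]
    · intro i j z hi hj
      by_contra hij
      have h1 := str_interior (hp i) hi
      have h2 := str_interior (hp j) hj
      rw [hr, ← image_interior_triSet] at h1 h2
      obtain ⟨x, hx, rfl⟩ := h1
      obtain ⟨y, hy, hxy⟩ := h2
      have := Φ.injective hxy
      subst this
      have h3 : y ∈ interior (triSet (tiles i)) ∩ interior (triSet (tiles j)) := ⟨hx, hy⟩
      rw [ht.disj i j hij] at h3
      exact h3
  exact Setup.big (a := a) (b := b) (c := c) (X := X) (ea := ea) (eb := eb) (g := g) (V := V)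
    ⟨S, ha, hb, hc, hX, na, nb, hg, tri, ang, irr, htile⟩


/-- Let the equilateral triangle `ABC` be `N`-tiled by a tile with angles
`(α, β, γ)`, where `γ = π/3` or `γ = 2π/3` and `α` is not a rational multiple
of `π`.  Then `N ≥ 40`. -/
theorem equilateral_tiling_forty (N : ℕ) (ABC T : Tri)
    (hABC : IsTriangle ABC) (hT : IsTriangle T)
    (heq : IsEquilateral ABC)
    (α β γ : ℝ) (hangles : HasAngles T α β γ)
    (hγ : γ = π / 3 ∨ γ = 2 * π / 3)
    (hirr : ¬ ∃ q : ℚ, α = (q : ℝ) * π)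
    (tiles : Fin N → Tri) (ht : IsTiling N ABC T tiles) :
    40 ≤ N := by
  exact main40 N ABC T hABC hT heq α β γ hangles hγ hirr tiles ht
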